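/- arXiv:2405.05375 — 3 statements merged into one kernel-verified Lean document; each statement's English description precedes it below -/
import Mathlib

section
/- Let G be a connected simple graph with m edges, m ≥ 3, such that every vertex of degree at least three is a support vertex. Then G is product antimagic, i.e., there exists a bijection φ from the edge set of G to {1, 2, ..., m} such that the induced vertex products φ∘(u) = Π_{uv ∈ E} φ(uv) are pairwise distinct. -/
open scoped Classical

noncomputable def edgeFS {V : Type*} [Fintype V] (G : SimpleGraph V) : Finset (Sym2 V) :=
  G.edgeSet.toFinset

noncomputable def vSum {V : Type*} [Fintype V] (G : SimpleGraph V) (φ : Sym2 V → ℝ) (v : V) : ℝ :=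
  ∑ e ∈ (edgeFS G).filter (fun e => v ∈ e), φ e

noncomputable def vProd {V : Type*} [Fintype V] (G : SimpleGraph V) (φ : Sym2 V → ℝ) (v : V) : ℝ :=
  ∏ e ∈ (edgeFS G).filter (fun e => v ∈ e), φ e

open Finset in
theorem bijOn_rank {E α : Type*} [LinearOrder α] (Es : Finset E) (ord : E → α)
    (hinj : Set.InjOn ord Es) :
    Set.BijOn (fun e => #{e' ∈ Es | ord e' ≤ ord e}) ↑Es ↑(Icc 1 #Es) := by
  have hmono : ∀ e ∈ Es, ∀ e' ∈ Es, ord e < ord e' →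
      #{a ∈ Es | ord a ≤ ord e} < #{a ∈ Es | ord a ≤ ord e'} := by
    intro e _ e' he' hlt
    apply card_lt_card
    refine (ssubset_iff_of_subset ?_).2 ⟨e', by simp [he'], by simp [hlt]⟩
    intro a ha
    simp only [mem_filter] at ha ⊢
    exact ⟨ha.1, ha.2.trans hlt.le⟩
  have hmaps : ∀ e ∈ Es, #{a ∈ Es | ord a ≤ ord e} ∈ Icc 1 #Es := by
    intro e he
    refine mem_Icc.2 ⟨card_pos.2 ⟨e, by simp [he]⟩, card_le_card (filter_subset _ _)⟩
  have hi : Set.InjOn (fun e => #{e' ∈ Es | ord e' ≤ ord e}) ↑Es := by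
    intro e he e' he' h
    rcases lt_trichotomy (ord e) (ord e') with hlt | heq | hlt
    · exact absurd h (hmono e he e' he' hlt).ne
    · exact hinj he he' heq
    · exact absurd h (hmono e' he' e he hlt).ne'
  refine ⟨fun e he => hmaps e he, hi, ?_⟩
  exact surjOn_of_injOn_of_card_le _ hmaps hi (by simp)

/-- The data from which a product antimagic labelling is read off.  The edges are ranked by
`cls`, then by `key`.  Vertices in `dd` see one edge of class `0` and one of class `3`, every vertex
of `br` owns an edge of class `2`, and the product at a vertex of `tip` is a single label. -/
structure IsScheme {V E : Type*} (Es : Finset E) (I : V → Finset E) (tip dd br : Set V)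
    (ε a b ρ : V → E) (cls key : E → ℕ) : Prop where
  cover : ∀ v, v ∈ tip ∨ v ∈ dd ∨ v ∈ br
  sub : ∀ v, I v ⊆ Es
  tip_mem : ∀ v ∈ tip, ε v ∈ Es
  tip_inc : ∀ v ∈ tip, I v = {ε v} ∨ ∃ e₁ ∈ Es, e₁ ≠ ε v ∧ I v = {ε v, e₁} ∧ cls e₁ = 0 ∧
    ∀ e ∈ Es, e ≠ e₁ → cls e₁ < cls e ∨ (cls e₁ = cls e ∧ key e₁ < key e)
  tip_inj : Set.InjOn ε tip
  tip_cls : ∀ v ∈ tip, cls (ε v) ≤ 2 ∨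
    (cls (ε v) = 3 ∧ ∀ x ∈ dd, b x = ε v → ∃ e ∈ Es, cls e = 0 ∧ key e < key (a x)) ∨
    (4 ≤ cls (ε v) ∧ (Es.filter (fun e => 4 ≤ cls e)).card = 1)
  dd_inc : ∀ x ∈ dd, I x = {a x, b x}
  dd_fst : ∀ x ∈ dd, cls (a x) = 0
  dd_snd : ∀ x ∈ dd, cls (b x) = 3
  dd_comp : ∀ x ∈ dd, ∀ y ∈ dd, x ≠ y →
    ((a x = a y ∧ key (b x) < key (b y)) ∨ (key (a x) < key (a y) ∧ b x = b y) ∨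
      (key (a x) < key (a y) ∧ key (b x) < key (b y))) ∨
    ((a y = a x ∧ key (b y) < key (b x)) ∨ (key (a y) < key (a x) ∧ b y = b x) ∨
      (key (a y) < key (a x) ∧ key (b y) < key (b x)))
  br_mem : ∀ v ∈ br, ρ v ∈ I v
  br_cls : ∀ v ∈ br, cls (ρ v) = 2
  br_uniq : ∀ v ∈ br, ∀ e ∈ I v, cls e = 2 → e = ρ v
  br_inj : Set.InjOn ρ br
  br_good : ∀ v ∈ br, (3 ≤ (I v).card ∧ ∃ e ∈ I v, 4 ≤ cls e) ∨
    ∃ e ∈ I v, cls e = 3 ∧ (∃ e₀ ∈ Es, cls e₀ = 0) ∧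
      ((∀ e' ∈ Es, cls e' = 3 → e' ≠ e → key e' < key e) ∨
        ∃ d ∈ I v, d ≠ e ∧ cls d ≠ 2 ∧ ∃ e₀ ∈ Es, cls e₀ = 0 ∧ (cls d ≠ 0 ∨ key e₀ < key d))
  count : (Es.filter (fun e => cls e = 3)).card ≤ (Es.filter (fun e => cls e < 3)).card

/-- Numerical facts about a ranking of the edges of a scheme. -/
structure IsRanking {E : Type*} (Es : Finset E) (cls key : E → ℕ) (φ : E → ℕ)
    (h k n : ℕ) : Prop where
  bij : Set.BijOn φ ↑Es ↑(Finset.Icc 1 Es.card)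
  cls_lt : ∀ e ∈ Es, ∀ e' ∈ Es, cls e < cls e' → φ e < φ e'
  key_lt : ∀ e ∈ Es, ∀ e' ∈ Es, cls e = cls e' → key e < key e' → φ e < φ e'
  le_h : ∀ e ∈ Es, cls e = 0 → φ e ≤ h
  h_lt : ∀ e ∈ Es, cls e ≠ 0 → h < φ e
  le_k : ∀ e ∈ Es, cls e ≤ 2 → φ e ≤ k
  k_lt : ∀ e ∈ Es, 3 ≤ cls e → k < φ e
  le_n : ∀ e ∈ Es, cls e ≤ 3 → φ e ≤ n
  n_lt : ∀ e ∈ Es, 4 ≤ cls e → n < φ e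
  n_le : ∀ e ∈ Es, cls e = 3 → (∀ e' ∈ Es, cls e' = 3 → e' ≠ e → key e' < key e) → n ≤ φ e
  eq_one : ∀ e₁ ∈ Es, (∀ e ∈ Es, e ≠ e₁ → cls e₁ < cls e ∨ (cls e₁ = cls e ∧ key e₁ < key e)) →
    φ e₁ = 1

open Finset in
theorem exists_ranking {E : Type*} (Es : Finset E) (cls : E → ℕ) :
    ∃ Φ : (E → ℕ) → E → ℕ,
      (∀ key, IsRanking Es cls key (Φ key) #{e ∈ Es | cls e = 0} #{e ∈ Es | cls e < 3}
        #{e ∈ Es | cls e < 4}) ∧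
      ∀ key key' : E → ℕ, (∀ e, cls e ≠ 2 → key e = key' e) →
        ∀ e, cls e ≠ 2 → Φ key e = Φ key' e := by
  obtain ⟨idx, hidx⟩ := Set.countable_iff_exists_injOn.1 (Es.finite_toSet.countable)
  let ord : (E → ℕ) → E → ℕ ×ₗ ℕ ×ₗ ℕ := fun key e => toLex (cls e, toLex (key e, idx e))
  have hord : ∀ key e e', ord key e ≤ ord key e' ↔ cls e < cls e' ∨ (cls e = cls e' ∧
      (key e < key e' ∨ (key e = key e' ∧ idx e ≤ idx e'))) := by
    intro key e e'
    simp [ord, Prod.Lex.le_iff]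
  refine ⟨fun key e => #{e' ∈ Es | ord key e' ≤ ord key e}, fun key => ?_, ?_⟩
  · have hb := bijOn_rank Es (ord key) (by
      intro e he e' he' h
      have h1 := (hord key e e').1 h.le
      have h2 := (hord key e' e).1 h.ge
      exact hidx he he' (by omega))
    have hcl : ∀ e ∈ Es, ∀ e' ∈ Es, cls e < cls e' ∨ (cls e = cls e' ∧ key e < key e') →
      #{a ∈ Es | ord key a ≤ ord key e} < #{a ∈ Es | ord key a ≤ ord key e'} := by
      intro e he e' he' hlt
      apply card_lt_card
      refine (ssubset_iff_of_subset ?_).2 ⟨e', by simp [he'], ?_⟩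
      · intro a ha
        simp only [mem_filter, hord] at ha ⊢
        refine ⟨ha.1, ?_⟩
        omega
      · simp only [mem_filter, hord, not_and]
        intro _
        omega
    have hup : ∀ e ∈ Es, ∀ P : E → Prop, [DecidablePred P] → (∀ a ∈ Es, ord key a ≤ ord key e → P a) →
        #{a ∈ Es | ord key a ≤ ord key e} ≤ #{a ∈ Es | P a} := by
      intro e he P _ hP
      apply card_le_card
      intro a ha
      simp only [mem_filter] at ha ⊢
      exact ⟨ha.1, hP a ha.1 ha.2⟩
    have hlo : ∀ e ∈ Es, ∀ P : E → Prop, [DecidablePred P] → (∀ a ∈ Es, P a → ord key a ≤ ord key e) →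
        #{a ∈ Es | P a} ≤ #{a ∈ Es | ord key a ≤ ord key e} := by
      intro e he P _ hP
      apply card_le_card
      intro a ha
      simp only [mem_filter] at ha ⊢
      exact ⟨ha.1, hP a ha.1 ha.2⟩
    have hlo' : ∀ e ∈ Es, ∀ P : E → Prop, [DecidablePred P] → ¬ P e →
        (∀ a ∈ Es, P a → ord key a ≤ ord key e) →
        #{a ∈ Es | P a} < #{a ∈ Es | ord key a ≤ ord key e} := by
      intro e he P _ hPe hP
      apply card_lt_card
      refine (ssubset_iff_of_subset ?_).2 ⟨e, by simp [he], by simp [hPe]⟩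
      intro a ha
      simp only [mem_filter] at ha ⊢
      exact ⟨ha.1, hP a ha.1 ha.2⟩
    refine ⟨hb, fun e he e' he' h => hcl e he e' he' (Or.inl h),
      fun e he e' he' h h' => hcl e he e' he' (Or.inr ⟨h, h'⟩), ?_, ?_, ?_, ?_, ?_, ?_, ?_, ?_⟩
    · intro e he h
      exact hup e he _ (fun a _ => by rw [hord]; omega)
    · intro e he h
      exact hlo' e he _ h (fun a _ => by rw [hord]; omega)
    · intro e he h
      exact hup e he _ (fun a _ => by rw [hord]; omega)
    · intro e he h
      exact hlo' e he _ (by omega) (fun a _ => by rw [hord]; omega)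
    · intro e he h
      exact hup e he _ (fun a _ => by rw [hord]; omega)
    · intro e he h
      exact hlo' e he _ (by omega) (fun a _ => by rw [hord]; omega)
    · intro e he h hmax
      refine hlo e he _ (fun a ha h4 => ?_)
      rw [hord]
      by_cases hae : a = e
      · subst hae; omega
      · have := hmax a ha
        by_cases h3 : cls a = 3
        · have := this h3 hae; omega
        · omega
    · intro e he hmin
      have : ({a ∈ Es | ord key a ≤ ord key e} : Finset E) = {e} := by
        ext a
        simp only [mem_filter, mem_singleton]
        constructor
        · rintro ⟨ha, hle⟩
          by_contra hne
          have := hmin a ha hne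
          rw [hord] at hle
          omega
        · rintro rfl
          exact ⟨he, le_rfl⟩
      simp [this]
  · intro key key' hk e he
    refine congrArg Finset.card (filter_congr ?_)
    intro a _
    rw [hord, hord]
    by_cases ha : cls a = 2
    · omega
    · rw [hk a ha, hk e he]

/-- A scheme remains valid when the keys of the edges of class `2` are changed. -/
theorem IsScheme.change_key {V E : Type*} {Es : Finset E} {I : V → Finset E} {tip dd br : Set V}
    {ε a b ρ : V → E} {cls key : E → ℕ} (hs : IsScheme Es I tip dd br ε a b ρ cls key)
    (key' : E → ℕ) (hk : ∀ e, cls e ≠ 2 → key' e = key e) :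
    IsScheme Es I tip dd br ε a b ρ cls key' := by
  have h0 : ∀ e, cls e = 0 → key' e = key e := fun e he => hk e (by omega)
  have h3 : ∀ e, cls e = 3 → key' e = key e := fun e he => hk e (by omega)
  refine { hs with tip_inc := ?_, tip_cls := ?_, dd_comp := ?_, br_good := ?_ }
  · intro v hv
    rcases hs.tip_inc v hv with h | ⟨e₁, he₁, hne, hI, hc, hlt⟩
    · exact Or.inl h
    · refine Or.inr ⟨e₁, he₁, hne, hI, hc, fun e he hne => ?_⟩
      rcases hlt e he hne with h | ⟨h, h'⟩
      · exact Or.inl h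
      · right
        rw [h0 e₁ hc, h0 e (by omega)]
        exact ⟨h, h'⟩
  · intro v hv
    rcases hs.tip_cls v hv with h | ⟨h, hx⟩ | h
    · exact Or.inl h
    · refine Or.inr (Or.inl ⟨h, fun x hxd hb => ?_⟩)
      obtain ⟨e, he, hc, hlt⟩ := hx x hxd hb
      refine ⟨e, he, hc, ?_⟩
      rwa [h0 e hc, h0 _ (hs.dd_fst x hxd)]
    · exact Or.inr (Or.inr h)
  · intro x hx y hy hxy
    rw [h0 _ (hs.dd_fst x hx), h0 _ (hs.dd_fst y hy), h3 _ (hs.dd_snd x hx),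
      h3 _ (hs.dd_snd y hy)]
    exact hs.dd_comp x hx y hy hxy
  · intro v hv
    rcases hs.br_good v hv with h | ⟨e, he, hc, hex, h⟩
    · exact Or.inl h
    · refine Or.inr ⟨e, he, hc, hex, ?_⟩
      rcases h with h | ⟨d, hd, hde, hd2, e₀, he₀, hc0, hlt⟩
      · left
        intro e' he' hc' hne
        rw [h3 _ hc, h3 _ hc']
        exact h e' he' hc' hne
      · refine Or.inr ⟨d, hd, hde, hd2, e₀, he₀, hc0, ?_⟩
        rwa [h0 _ hc0, hk _ hd2]

open Finset in
/-- The vertex products of a ranking of a scheme are distinct as soon as those at the vertices of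
`br` are distinct from each other. -/
theorem IsScheme.injective_prod {V E : Type*} {Es : Finset E} {I : V → Finset E}
    {tip dd br : Set V} {ε a b ρ : V → E} {cls key φ : E → ℕ}
    (hs : IsScheme Es I tip dd br ε a b ρ cls key)
    (hr : IsRanking Es cls key φ #{e ∈ Es | cls e = 0} #{e ∈ Es | cls e < 3} #{e ∈ Es | cls e < 4})
    (hbr : ∀ v ∈ br, ∀ w ∈ br, v ≠ w → ∏ e ∈ I v, φ e ≠ ∏ e ∈ I w, φ e) :
    Function.Injective (fun v => ∏ e ∈ I v, φ e) := by
  set h := #{e ∈ Es | cls e = 0} with hh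
  set k := #{e ∈ Es | cls e < 3} with hkdef
  set n := #{e ∈ Es | cls e < 4} with hn
  have hnk : n ≤ 2 * k := by
    have : n ≤ #{e ∈ Es | cls e < 3} + #{e ∈ Es | cls e = 3} := by
      rw [hn]
      refine le_trans (card_le_card ?_) (card_union_le _ _)
      intro e he
      simp only [mem_filter, mem_union] at he ⊢
      have := he.1
      have := he.2
      by_cases h3 : cls e = 3
      · exact Or.inr ⟨he.1, h3⟩
      · exact Or.inl ⟨he.1, by omega⟩
    have := hs.count
    omega
  have hpos : ∀ e ∈ Es, 1 ≤ φ e := fun e he => (mem_Icc.1 (hr.bij.mapsTo he)).1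
  have hφinj : ∀ e ∈ Es, ∀ e' ∈ Es, φ e = φ e' → e = e' := fun e he e' he' h =>
    hr.bij.injOn he he' h
  have hL : ∀ e ∈ Es, cls e = 3 → n + 2 ≤ 2 * φ e := by
    intro e he hc
    have := hr.k_lt e he (by omega)
    omega
  have htip : ∀ v ∈ tip, ∏ e ∈ I v, φ e = φ (ε v) := by
    intro v hv
    rcases hs.tip_inc v hv with hI | ⟨e₁, he₁, hne, hI, -, hlt⟩
    · rw [hI, prod_singleton]
    · rw [hI, prod_pair hne.symm, hr.eq_one e₁ he₁ hlt, mul_one]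
  have hdmem : ∀ x ∈ dd, a x ∈ Es ∧ b x ∈ Es := by
    intro x hx
    have h1 := hs.sub x
    rw [hs.dd_inc x hx] at h1
    exact ⟨h1 (by simp), h1 (by simp)⟩
  have hdd : ∀ x ∈ dd, ∏ e ∈ I x, φ e = φ (a x) * φ (b x) := by
    intro x hx
    rw [hs.dd_inc x hx, prod_pair]
    intro hab
    have h1 := hs.dd_fst x hx
    have h2 := hs.dd_snd x hx
    rw [hab] at h1
    omega
  have hddle : ∀ x ∈ dd, φ (a x) * φ (b x) ≤ h * n := fun x hx =>
    Nat.mul_le_mul (hr.le_h _ (hdmem x hx).1 (hs.dd_fst x hx))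
      (hr.le_n _ (hdmem x hx).2 (hs.dd_snd x hx).le)
  -- upper bound for the labels at the tips
  have htiple : ∀ v ∈ tip, φ (ε v) ≤ n ∨ (φ (ε v) = n + 1 ∧ 4 ≤ cls (ε v) ∧
      #{e ∈ Es | 4 ≤ cls e} = 1) := by
    intro v hv
    by_cases h4 : cls (ε v) < 4
    · exact Or.inl (hr.le_n _ (hs.tip_mem v hv) (by omega))
    · right
      rcases hs.tip_cls v hv with h | ⟨h, -⟩ | ⟨h, h1⟩
      · omega
      · omega
      · refine ⟨?_, h, h1⟩
        have h2 := hr.n_lt _ (hs.tip_mem v hv) h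
        have h3 := (mem_Icc.1 (hr.bij.mapsTo (hs.tip_mem v hv))).2
        have h4 : #Es = n + 1 := by
          rw [← h1, hn, ← card_filter_add_card_filter_not (s := Es) (fun e => cls e < 4)]
          simp only [not_lt]
        omega
  have hsub2 : ∀ v, ∀ s : Finset E, s ⊆ I v → ∏ e ∈ s, φ e ≤ ∏ e ∈ I v, φ e := by
    intro v s hsv
    exact prod_le_prod_of_subset_of_one_le' hsv (fun e he _ => hpos e (hs.sub v he))
  have hbrbig : ∀ v ∈ br, h * n < ∏ e ∈ I v, φ e ∧
      ∀ w ∈ tip, φ (ε w) < ∏ e ∈ I v, φ e := by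
    intro v hv
    have hρ := hs.br_mem v hv
    have hρE := hs.sub v hρ
    have hρh := hr.h_lt _ hρE (by rw [hs.br_cls v hv]; omega)
    rcases hs.br_good v hv with ⟨h3, x, hx, hx4⟩ | ⟨l, hl, hl3, ⟨e₀, he₀, hc₀⟩, hmax | hd⟩
    · have hxρ : x ≠ ρ v := by
        rintro rfl
        have := hs.br_cls v hv
        omega
      have hxn := hr.n_lt x (hs.sub v hx) hx4
      obtain ⟨d, hd, hdx⟩ : ∃ d ∈ I v, d ∉ ({x, ρ v} : Finset E) := by
        by_contra hcon
        push Not at hcon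
        have h1 := card_le_card (show I v ⊆ {x, ρ v} from hcon)
        have h2 := card_le_two (a := x) (b := ρ v)
        omega
      simp only [mem_insert, mem_singleton, not_or] at hdx
      have hprod : φ x * (φ (ρ v) * φ d) ≤ ∏ e ∈ I v, φ e := by
        have := hsub2 v {x, ρ v, d} (by
          intro e he
          simp only [mem_insert, mem_singleton] at he
          rcases he with rfl | rfl | rfl <;> assumption)
        rwa [prod_insert (by simp [hxρ, Ne.symm hdx.1]), prod_pair (Ne.symm hdx.2)] at this
      have hd1 := hpos d (hs.sub v hd)
      have hρ1 := hpos _ hρE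
      have hne : φ (ρ v) ≠ φ d := fun hc => hdx.2 (hφinj _ hρE _ (hs.sub v hd) hc).symm
      have h2 : 2 ≤ φ (ρ v) * φ d := by
        rcases Nat.lt_or_ge 1 (φ d) with h | h
        · nlinarith
        · have : 2 ≤ φ (ρ v) := by omega
          nlinarith
      constructor
      · have h4 : h + 1 ≤ φ (ρ v) * φ d := by nlinarith
        nlinarith [Nat.mul_le_mul hxn h4]
      · intro w hw
        have h5 := Nat.mul_le_mul hxn h2
        rcases htiple w hw with h6 | ⟨h6, -⟩ <;> omega
    · have hln := hr.n_le l (hs.sub v hl) hl3 hmax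
      have hlρ : l ≠ ρ v := by
        rintro rfl
        have := hs.br_cls v hv
        omega
      have hprod := hsub2 v {l, ρ v} (by
          intro e he
          simp only [mem_insert, mem_singleton] at he
          rcases he with rfl | rfl <;> assumption)
      rw [prod_pair hlρ] at hprod
      have h1 := hpos e₀ he₀
      have h2 := hr.le_h e₀ he₀ hc₀
      have h3 := hr.cls_lt e₀ he₀ l (hs.sub v hl) (by omega)
      have h4 := hr.le_n l (hs.sub v hl) hl3.le
      have h5 := Nat.mul_le_mul hln hρh
      simp only [Nat.succ_eq_add_one] at h5
      constructor
      · nlinarith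
      · intro w hw
        have h6 : n * 2 ≤ n * (h + 1) := Nat.mul_le_mul_left n (by omega)
        rcases htiple w hw with h6 | ⟨h6, -⟩ <;> omega
    · obtain ⟨d, hd, hdl, hd2, e₁, he₁, hc₁, hlt⟩ := hd
      have hlρ : l ≠ ρ v := by
        rintro rfl
        have := hs.br_cls v hv
        omega
      have hdρ : d ≠ ρ v := by
        rintro rfl
        exact hd2 (hs.br_cls v hv)
      have hprod : φ l * (φ (ρ v) * φ d) ≤ ∏ e ∈ I v, φ e := by
        have := hsub2 v {l, ρ v, d} (by
          intro e he
          simp only [mem_insert, mem_singleton] at he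
          rcases he with rfl | rfl | rfl <;> assumption)
        rwa [prod_insert (by simp [hlρ, Ne.symm hdl]), prod_pair (Ne.symm hdρ)] at this
      have h1 := hpos e₁ he₁
      have h2 := hr.le_h e₁ he₁ hc₁
      have hdE := hs.sub v hd
      have hd2 : 2 ≤ φ d := by
        by_cases hc : cls d = 0
        · have := hr.key_lt e₁ he₁ d hdE (by omega) (by omega)
          omega
        · have := hr.h_lt d hdE hc
          omega
      have h3 := hL l (hs.sub v hl) hl3
      have h4 := Nat.mul_le_mul h3 hρh
      simp only [Nat.succ_eq_add_one] at h4
      have h5 : φ l * (φ (ρ v) * 2) ≤ φ l * (φ (ρ v) * φ d) :=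
        Nat.mul_le_mul_left _ (Nat.mul_le_mul_left _ hd2)
      constructor
      · nlinarith
      · intro w hw
        have h6 : (n + 2) * 1 ≤ (n + 2) * (h + 1) := Nat.mul_le_mul_left _ (by omega)
        have h7 : 2 * φ l * φ (ρ v) = φ l * (φ (ρ v) * 2) := by ring
        rcases htiple w hw with h6 | ⟨h6, -⟩ <;> omega
  have htd : ∀ v ∈ tip, ∀ x ∈ dd, φ (ε v) ≠ φ (a x) * φ (b x) := by
    intro v hv x hx heq
    obtain ⟨haE, hbE⟩ := hdmem x hx
    have ha1 := hpos _ haE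
    have hb3 := hs.dd_snd x hx
    have hbl := hL _ hbE hb3
    have hbk := hr.k_lt _ hbE hb3.ge
    have hbn := hr.le_n _ hbE hb3.le
    have hbp : φ (b x) ≤ φ (a x) * φ (b x) := Nat.le_mul_of_pos_left _ ha1
    have ha2 : φ (a x) = 1 ∨ 2 * φ (b x) ≤ φ (a x) * φ (b x) := by
      rcases Nat.lt_or_ge 1 (φ (a x)) with h | h
      · exact Or.inr (Nat.mul_le_mul_right _ h)
      · exact Or.inl (by omega)
    rcases hs.tip_cls v hv with hc | ⟨hc, hex⟩ | ⟨hc, -⟩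
    · have := hr.le_k _ (hs.tip_mem v hv) hc
      omega
    · have hvn := hr.le_n _ (hs.tip_mem v hv) hc.le
      rcases ha2 with h1 | h2
      · rw [h1, one_mul] at heq
        have hbe := hφinj _ (hs.tip_mem v hv) _ hbE heq
        obtain ⟨e, he, hce, hlt⟩ := hex x hx hbe.symm
        have := hr.key_lt e he _ haE (by rw [hce, hs.dd_fst x hx]) hlt
        have := hpos e he
        omega
      · omega
    · have hvn := hr.n_lt _ (hs.tip_mem v hv) hc
      rcases htiple v hv with h5 | ⟨h5, -⟩
      · omega
      · rcases ha2 with h1 | h2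
        · rw [h1, one_mul] at heq
          omega
        · omega
  have hlts : ∀ x ∈ dd, ∀ y ∈ dd, ((a x = a y ∧ key (b x) < key (b y)) ∨
      (key (a x) < key (a y) ∧ b x = b y) ∨
      (key (a x) < key (a y) ∧ key (b x) < key (b y))) →
      φ (a x) * φ (b x) < φ (a y) * φ (b y) := by
    intro x hx y hy hxy
    obtain ⟨hax, hbx⟩ := hdmem x hx
    obtain ⟨hay, hby⟩ := hdmem y hy
    have hak : key (a x) < key (a y) → φ (a x) < φ (a y) :=
      hr.key_lt _ hax _ hay (by rw [hs.dd_fst x hx, hs.dd_fst y hy])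
    have hbk : key (b x) < key (b y) → φ (b x) < φ (b y) :=
      hr.key_lt _ hbx _ hby (by rw [hs.dd_snd x hx, hs.dd_snd y hy])
    rcases hxy with ⟨h1, h2⟩ | ⟨h1, h2⟩ | ⟨h1, h2⟩
    · rw [h1]
      exact Nat.mul_lt_mul_of_pos_left (hbk h2) (hpos _ hay)
    · rw [h2]
      exact Nat.mul_lt_mul_of_pos_right (hak h1) (hpos _ hby)
    · exact Nat.mul_lt_mul'' (hak h1) (hbk h2)
  intro v w hvw
  simp only at hvw
  by_contra hne
  rcases hs.cover v with hv | hv | hv <;> rcases hs.cover w with hw | hw | hw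
  · rw [htip v hv, htip w hw] at hvw
    exact hne (hs.tip_inj hv hw (hφinj _ (hs.tip_mem v hv) _ (hs.tip_mem w hw) hvw))
  · rw [htip v hv, hdd w hw] at hvw
    exact htd v hv w hw hvw
  · rw [htip v hv] at hvw
    exact ((hbrbig w hw).2 v hv).ne hvw
  · rw [htip w hw, hdd v hv] at hvw
    exact htd w hw v hv hvw.symm
  · rw [hdd v hv, hdd w hw] at hvw
    rcases hs.dd_comp v hv w hw hne with h1 | h1
    · exact (hlts v hv w hw h1).ne hvw
    · exact (hlts w hw v hv h1).ne' hvw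
  · rw [hdd v hv] at hvw
    exact (lt_of_le_of_lt (hddle v hv) (hbrbig w hw).1).ne hvw
  · rw [htip w hw] at hvw
    exact ((hbrbig v hv).2 w hw).ne' hvw
  · rw [hdd w hw] at hvw
    exact (lt_of_le_of_lt (hddle w hw) (hbrbig v hv).1).ne' hvw
  · exact hbr v hv w hw hne hvw

open Finset in
/-- A scheme gives rise to a labelling with distinct vertex products. -/
theorem IsScheme.exists_labelling {V E : Type*} {Es : Finset E} {I : V → Finset E}
    {tip dd br : Set V} {ε a b ρ : V → E} {cls key : E → ℕ}
    (hs : IsScheme Es I tip dd br ε a b ρ cls key) :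
    ∃ φ : E → ℕ, Set.BijOn φ ↑Es ↑(Icc 1 #Es) ∧
      Function.Injective (fun v => ∏ e ∈ I v, φ e) := by
  obtain ⟨Φ, hΦ, hΦ2⟩ := exists_ranking Es cls
  let f : V → ℕ := fun v => ∏ e ∈ (I v).erase (ρ v), Φ key e
  let key' : E → ℕ := fun e =>
    if h : cls e = 2 ∧ ∃ v ∈ br, ρ v = e then f h.2.choose else key e
  have hk : ∀ e, cls e ≠ 2 → key' e = key e := fun e he => dif_neg (fun h => he h.1)
  have hkf : ∀ v ∈ br, key' (ρ v) = f v := by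
    intro v hv
    have h : cls (ρ v) = 2 ∧ ∃ w ∈ br, ρ w = ρ v := ⟨hs.br_cls v hv, v, hv, rfl⟩
    have h1 : key' (ρ v) = f h.2.choose := dif_pos h
    rw [h1, hs.br_inj h.2.choose_spec.1 hv h.2.choose_spec.2]
  have hs' := hs.change_key key' hk
  have hr := hΦ key'
  have hfv : ∀ v ∈ br, ∏ e ∈ I v, Φ key' e = Φ key' (ρ v) * f v := by
    intro v hv
    rw [← mul_prod_erase _ _ (hs.br_mem v hv)]
    congr 1
    refine prod_congr rfl fun e he => hΦ2 key' key hk e fun h2 => ?_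
    exact (mem_erase.1 he).1 (hs.br_uniq v hv e (mem_erase.1 he).2 h2)
  have hρE : ∀ v ∈ br, ρ v ∈ Es := fun v hv => hs.sub v (hs.br_mem v hv)
  have hfpos : ∀ v ∈ br, 0 < f v := by
    intro v hv
    refine prod_pos fun e he => ?_
    exact (mem_Icc.1 ((hΦ key).bij.mapsTo (hs.sub v (mem_erase.1 he).2))).1
  have hlt : ∀ v ∈ br, ∀ w ∈ br, f v < f w →
      ∏ e ∈ I v, Φ key' e < ∏ e ∈ I w, Φ key' e := by
    intro v hv w hw hvw
    rw [hfv v hv, hfv w hw]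
    refine Nat.mul_lt_mul'' (hr.key_lt _ (hρE v hv) _ (hρE w hw) ?_ ?_) hvw
    · rw [hs.br_cls v hv, hs.br_cls w hw]
    · rwa [hkf v hv, hkf w hw]
  refine ⟨Φ key', hr.bij, hs'.injective_prod hr fun v hv w hw hne heq => ?_⟩
  rcases lt_trichotomy (f v) (f w) with h | h | h
  · exact (hlt v hv w hw h).ne heq
  · rw [hfv v hv, hfv w hw, h] at heq
    exact hne (hs.br_inj hv hw (hr.bij.injOn (hρE v hv) (hρE w hw)
      (Nat.eq_of_mul_eq_mul_right (hfpos w hw) heq)))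
  · exact (hlt w hw v hv h).ne' heq

/-- The vertices of `dd` are ordered by `ν`; each has a first edge `p x` and a second edge `q x`,
and the second edge of a vertex may only be the first edge of its successor. -/
structure IsThreading {V E : Type*} (dd : Set V) (p q : V → E) (ν : V → ℕ) : Prop where
  ne : ∀ x ∈ dd, p x ≠ q x
  p_inj : Set.InjOn p dd
  q_inj : Set.InjOn q dd
  ν_inj : Set.InjOn ν dd
  succ : ∀ x ∈ dd, ∀ z ∈ dd, q x = p z → ν z = ν x + 1

/-- The two edges at each vertex can be given alternating colours, with prescribed colours at the
ends of the threads. -/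
theorem IsThreading.exists_coloring {V E : Type*} [Finite V] {dd : Set V} {p q : V → E} {ν : V → ℕ}
    (hc : IsThreading dd p q ν) (β : V → Bool) :
    ∃ g : V → Bool, (∀ x ∈ dd, ∀ z ∈ dd, q x = p z → g z = !g x) ∧
      ∀ x ∈ dd, (∀ z ∈ dd, q x ≠ p z) → g x = β x := by
  let F : (V → Bool) → V → Bool := fun g x =>
    if h : ∃ z ∈ dd, q x = p z then !g h.choose else β x
  have hF : ∀ g x z, z ∈ dd → q x = p z → F g x = !g z := by
    intro g x z hz hxz
    have h : ∃ z ∈ dd, q x = p z := ⟨z, hz, hxz⟩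
    have h1 : F g x = !g h.choose := dif_pos h
    rw [h1, hc.p_inj h.choose_spec.1 hz (h.choose_spec.2.symm.trans hxz)]
  have hF' : ∀ g x, (∀ z ∈ dd, q x ≠ p z) → F g x = β x := by
    intro g x h
    exact dif_neg (by push Not; exact h)
  obtain ⟨N, hN⟩ := (Set.finite_range ν).bddAbove
  have hN : ∀ x, ν x ≤ N := fun x => hN ⟨x, rfl⟩
  have hstab : ∀ k, ∀ x ∈ dd, N < ν x + k → F^[k + 1] β x = F^[k] β x := by
    intro k
    induction k with
    | zero =>
      intro x _ h
      have := hN x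
      omega
    | succ k ih =>
      intro x hx h
      rw [Function.iterate_succ_apply', Function.iterate_succ_apply' F k]
      by_cases hz : ∃ z ∈ dd, q x = p z
      · obtain ⟨z, hz, hxz⟩ := hz
        rw [hF _ x z hz hxz, hF _ x z hz hxz, ← Function.iterate_succ_apply' F,
          ih z hz (by rw [hc.succ x hx z hz hxz]; omega)]
      · push Not at hz
        rw [hF' _ x hz, hF' _ x hz]
  have hst : ∀ x ∈ dd, F (F^[N + 1] β) x = F^[N + 1] β x := by
    intro x hx
    rw [← Function.iterate_succ_apply' F]
    exact hstab _ x hx (by omega)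
  refine ⟨F^[N + 1] β, fun x hx z hz hxz => ?_, fun x hx hfin => ?_⟩
  · rw [← hst x hx, hF _ x z hz hxz, Bool.not_not]
  · rw [← hst x hx, hF' _ x hfin]

/-- The small edge at a vertex of a chain. -/
def smallEdge {V E : Type*} (p q : V → E) (g : V → Bool) (x : V) : E := if g x then q x else p x

/-- The large edge at a vertex of a chain. -/
def largeEdge {V E : Type*} (p q : V → E) (g : V → Bool) (x : V) : E := if g x then p x else q x

/-- The class of an edge: `3` for the large edges of a chain, `0` for the small ones, and `c` for
the edges outside the chain. -/
noncomputable def chainCls {V E : Type*} (dd : Set V) (p q : V → E) (g : V → Bool) (c : E → ℕ)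
    (e : E) : ℕ :=
  if ∃ x ∈ dd, largeEdge p q g x = e then 3 else if ∃ x ∈ dd, smallEdge p q g x = e then 0 else c e

/-- The key of an edge: its position along the chain. -/
noncomputable def chainKey {V E : Type*} (dd : Set V) (p q : V → E) (ν : V → ℕ) (e : E) : ℕ :=
  if h : ∃ x ∈ dd, p x = e then 2 * ν h.choose
  else if h : ∃ x ∈ dd, q x = e then 2 * ν h.choose + 1 else 0

section Chain

variable {V E : Type*} {dd : Set V} {p q : V → E} {ν : V → ℕ} {g : V → Bool} {c : E → ℕ}

theorem smallEdge_or (p q : V → E) (g : V → Bool) (x : V) :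
    (smallEdge p q g x = p x ∧ largeEdge p q g x = q x) ∨
      (smallEdge p q g x = q x ∧ largeEdge p q g x = p x) := by
  cases h : g x <;> simp [smallEdge, largeEdge, h]

theorem IsThreading.key_fst (hc : IsThreading dd p q ν) {x : V} (hx : x ∈ dd) :
    chainKey dd p q ν (p x) = 2 * ν x := by
  have h : ∃ y ∈ dd, p y = p x := ⟨x, hx, rfl⟩
  rw [chainKey, dif_pos h, hc.p_inj h.choose_spec.1 hx h.choose_spec.2]

theorem IsThreading.key_snd (hc : IsThreading dd p q ν) {x : V} (hx : x ∈ dd) :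
    chainKey dd p q ν (q x) = 2 * ν x + 1 ∨
      ∃ z ∈ dd, q x = p z ∧ ν z = ν x + 1 ∧ chainKey dd p q ν (q x) = 2 * ν x + 2 := by
  by_cases hz : ∃ z ∈ dd, p z = q x
  · obtain ⟨z, hz, hzx⟩ := hz
    have hs := hc.succ x hx z hz hzx.symm
    refine Or.inr ⟨z, hz, hzx.symm, hs, ?_⟩
    rw [← hzx, hc.key_fst hz, hs]
    ring
  · left
    have h : ∃ y ∈ dd, q y = q x := ⟨x, hx, rfl⟩
    rw [chainKey, dif_neg hz, dif_pos h, hc.q_inj h.choose_spec.1 hx h.choose_spec.2]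

/-- Edges at earlier vertices of a chain have smaller keys. -/
theorem IsThreading.key_lt (hc : IsThreading dd p q ν) {x y : V} (hx : x ∈ dd) (hy : y ∈ dd)
    (hxy : ν x < ν y) {e e' : E} (he : e = p x ∨ e = q x) (he' : e' = p y ∨ e' = q y) :
    e = e' ∨ chainKey dd p q ν e < chainKey dd p q ν e' := by
  have h1 := hc.key_fst hx
  have h2 := hc.key_fst hy
  have h4 := hc.key_snd hy
  rcases hc.key_snd hx with h3 | ⟨z, hz, hzx, hzν, h3⟩
  · right
    rcases he with rfl | rfl <;> rcases he' with rfl | rfl <;> omega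
  · by_cases hzy : ν z = ν y
    · have := hc.ν_inj hz hy hzy
      subst this
      rcases he with rfl | rfl <;> rcases he' with rfl | rfl
      · right; omega
      · right; omega
      · left; assumption
      · right; omega
    · right
      rcases he with rfl | rfl <;> rcases he' with rfl | rfl <;> omega

theorem IsThreading.key_fst_lt_snd (hc : IsThreading dd p q ν) {x : V} (hx : x ∈ dd) :
    chainKey dd p q ν (p x) < chainKey dd p q ν (q x) := by
  have h1 := hc.key_fst hx
  rcases hc.key_snd hx with h2 | ⟨-, -, -, -, h2⟩ <;> omega

theorem IsThreading.small_ne_large (hc : IsThreading dd p q ν)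
    (hg : ∀ x ∈ dd, ∀ z ∈ dd, q x = p z → g z = !g x) {x y : V} (hx : x ∈ dd) (hy : y ∈ dd) :
    smallEdge p q g x ≠ largeEdge p q g y := by
  intro h
  unfold smallEdge largeEdge at h
  cases hgx : g x <;> cases hgy : g y <;> simp only [hgx, hgy, if_true, if_false,
    Bool.false_eq_true] at h
  · have := hg y hy x hx h.symm
    simp [hgx, hgy] at this
  · have := hc.p_inj hx hy h
    subst this
    simp [hgx] at hgy
  · have := hc.q_inj hx hy h
    subst this
    simp [hgx] at hgy
  · have := hg x hx y hy h
    simp [hgx, hgy] at this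

theorem chainCls_large {x : V} (hx : x ∈ dd) :
    chainCls dd p q g c (largeEdge p q g x) = 3 := if_pos ⟨x, hx, rfl⟩

theorem IsThreading.cls_small (hc : IsThreading dd p q ν)
    (hg : ∀ x ∈ dd, ∀ z ∈ dd, q x = p z → g z = !g x) {x : V} (hx : x ∈ dd) :
    chainCls dd p q g c (smallEdge p q g x) = 0 := by
  rw [chainCls, if_neg, if_pos ⟨x, hx, rfl⟩]
  rintro ⟨y, hy, h⟩
  exact hc.small_ne_large hg hx hy h.symm

theorem chainCls_of_not_mem {e : E} (h : ∀ x ∈ dd, p x ≠ e ∧ q x ≠ e) :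
    chainCls dd p q g c e = c e := by
  rw [chainCls, if_neg, if_neg]
  · rintro ⟨x, hx, h1⟩
    rcases smallEdge_or p q g x with h2 | h2 <;> rw [h2.1] at h1
    exacts [(h x hx).1 h1, (h x hx).2 h1]
  · rintro ⟨x, hx, h1⟩
    rcases smallEdge_or p q g x with h2 | h2 <;> rw [h2.2] at h1
    exacts [(h x hx).2 h1, (h x hx).1 h1]

theorem exists_large_of_cls {e : E} (hc3 : c e ≠ 3) (h : chainCls dd p q g c e = 3) :
    ∃ x ∈ dd, largeEdge p q g x = e := by
  by_contra hne
  rw [chainCls, if_neg hne] at h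
  split_ifs at h
  exact hc3 h

theorem exists_small_of_cls {e : E} (hc0 : c e ≠ 0) (h : chainCls dd p q g c e = 0) :
    ∃ x ∈ dd, smallEdge p q g x = e := by
  by_contra hne
  rw [chainCls, if_neg hne] at h
  split_ifs at h
  exact hc0 h

theorem IsThreading.comp (hc : IsThreading dd p q ν) {x y : V} (hx : x ∈ dd) (hy : y ∈ dd)
    (hxy : ν x < ν y) :
    let a := smallEdge p q g
    let b := largeEdge p q g
    let key := chainKey dd p q ν
    (a x = a y ∧ key (b x) < key (b y)) ∨ (key (a x) < key (a y) ∧ b x = b y) ∨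
      (key (a x) < key (a y) ∧ key (b x) < key (b y)) := by
  intro a b key
  have hx' := smallEdge_or p q g x
  have hy' := smallEdge_or p q g y
  have h1 : a x = a y ∨ key (a x) < key (a y) :=
    hc.key_lt hx hy hxy (hx'.imp And.left And.left) (hy'.imp And.left And.left)
  have h2 : b x = b y ∨ key (b x) < key (b y) :=
    hc.key_lt hx hy hxy (hx'.symm.imp And.right And.right) (hy'.symm.imp And.right And.right)
  have h3 : ¬ (a x = a y ∧ b x = b y) := by
    rintro ⟨h3, h4⟩
    have h5 : key (p x) = key (p y) ∨ key (p x) = key (q y) := by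
      simp only [a, b] at h3 h4
      rcases hx' with ⟨e1, e2⟩ | ⟨e1, e2⟩ <;> rcases hy' with ⟨e3, e4⟩ | ⟨e3, e4⟩ <;>
        rw [e1, e3] at h3 <;> rw [e2, e4] at h4 <;> simp [h3, h4]
    have h6 := hc.key_fst hx
    have h7 := hc.key_fst hy
    have h8 := hc.key_fst_lt_snd hy
    simp only [key] at h5
    omega
  tauto

/-- The small edge at the first vertex of a chain is the smallest. -/
theorem IsThreading.small_min (hc : IsThreading dd p q ν) (hc0 : ∀ e, c e ≠ 0) {s : V} (hs : s ∈ dd)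
    (hmin : ∀ x ∈ dd, ν s ≤ ν x) {e : E} (he : chainCls dd p q g c e = 0)
    (hne : e ≠ smallEdge p q g s) :
    chainKey dd p q ν (smallEdge p q g s) < chainKey dd p q ν e := by
  obtain ⟨y, hy, rfl⟩ := exists_small_of_cls (hc0 e) he
  have hsy : s ≠ y := fun h => hne (h ▸ rfl)
  have hlt : ν s < ν y := lt_of_le_of_ne (hmin y hy) (fun h => hsy (hc.ν_inj hs hy h))
  exact (hc.key_lt hs hy hlt ((smallEdge_or p q g s).imp And.left And.left)
    ((smallEdge_or p q g y).imp And.left And.left)).resolve_left (Ne.symm hne)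

/-- The second edge at the last vertex of a chain is the largest. -/
theorem IsThreading.snd_max (hc : IsThreading dd p q ν) (hc3 : ∀ e, c e ≠ 3) {s : V} (hs : s ∈ dd)
    (hmax : ∀ x ∈ dd, ν x ≤ ν s) {e : E} (he : chainCls dd p q g c e = 3) (hne : e ≠ q s) :
    chainKey dd p q ν e < chainKey dd p q ν (q s) := by
  obtain ⟨y, hy, rfl⟩ := exists_large_of_cls (hc3 e) he
  have hy' := (smallEdge_or p q g y).symm.imp And.right And.right
  by_cases hsy : s = y
  · subst hsy
    rcases hy' with h | h
    · rw [h]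
      exact hc.key_fst_lt_snd hs
    · exact absurd h hne
  · have hlt : ν y < ν s := lt_of_le_of_ne (hmax y hy) (fun h => hsy (hc.ν_inj hs hy h.symm))
    exact (hc.key_lt hy hs hlt hy' (Or.inr rfl)).resolve_left hne

end Chain

/-- An exploration order `n` of a graph, starting at `r`, that follows the vertices of `D`: it
leaves every vertex of `D` immediately, and visits neighbours in `D` as early as possible. -/
structure IsExploration {V : Type*} (H : SimpleGraph V) (D : Set V) (r : V) (n : V → ℕ) :
    Prop where
  inj : Function.Injective n
  root : n r = 0
  exists_lt : ∀ v, v ≠ r → ∃ u, H.Adj v u ∧ n u < n v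
  succ : ∀ x ∈ D, ∀ z, H.Adj x z → n x < n z → n z = n x + 1
  exists_succ : ∀ v, ∀ z ∈ D, H.Adj v z → n v < n z → ∃ z' ∈ D, H.Adj v z' ∧ n z' = n v + 1

open Finset in
theorem exists_isExploration {V : Type*} [Fintype V] (H : SimpleGraph V) (hH : H.Connected)
    (D : Set V) (r : V)
    (hD : ∀ x ∈ D, ∀ u z w, H.Adj x u → H.Adj x z → H.Adj x w → u ≠ z → u ≠ w → z = w)
    (hr : r ∈ D → ∀ z w, H.Adj r z → H.Adj r w → z = w) :
    ∃ n : V → ℕ, IsExploration H D r n := by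
  have key : ∀ k, k < Fintype.card V → ∃ (A : Finset V) (y : V) (n : V → ℕ), #A = k + 1 ∧
      y ∈ A ∧ r ∈ A ∧ n r = 0 ∧ n y = k ∧ Set.InjOn n A ∧ (∀ v ∈ A, n v ≤ k) ∧
      (∀ v ∈ A, v ≠ r → ∃ u ∈ A, H.Adj v u ∧ n u < n v) ∧
      (∀ x ∈ D, x ∈ A → x ≠ y → ∀ z, H.Adj x z → z ∈ A) ∧
      (∀ x ∈ D, x ∈ A → ∀ z ∈ A, H.Adj x z → n x < n z → n z = n x + 1) ∧
      (∀ v ∈ A, v ≠ y → ∀ z ∈ D, H.Adj v z → (z ∉ A ∨ n v < n z) →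
        ∃ z' ∈ D, z' ∈ A ∧ H.Adj v z' ∧ n z' = n v + 1) := by
    intro k
    induction k with
    | zero =>
      intro _
      refine ⟨{r}, r, fun _ => 0, ?_⟩
      simp
      grind
    | succ k ih =>
      intro hk
      obtain ⟨A, y, n, hA, hyA, hrA, hnr, hny, hinj, hle, hpar, hcl, hsucc, hD'⟩ := ih (by omega)
      -- at most one unexplored neighbour of a vertex of `D`
      have huniq : y ∈ D → ∀ z w, z ∉ A → w ∉ A → H.Adj y z → H.Adj y w → z = w := by
        intro hyD z w hz hw hyz hyw
        by_cases hyr : y = r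
        · subst hyr
          exact hr hyD z w hyz hyw
        · obtain ⟨u, huA, hyu, -⟩ := hpar y hyA hyr
          exact hD y hyD u z w hyu hyz hyw (fun h => hz (h ▸ huA)) (fun h => hw (h ▸ huA))
      obtain ⟨y', hy', ⟨u, huA, huy⟩, hyD, hyD'⟩ : ∃ y' ∉ A, (∃ u ∈ A, H.Adj y' u) ∧
          (∀ z ∈ D, z ∉ A → H.Adj y z → H.Adj y y' ∧ y' ∈ D) ∧
          (y ∈ D → ∀ z, z ∉ A → H.Adj y z → z = y') := by
        by_cases h1 : ∃ z ∈ D, z ∉ A ∧ H.Adj y z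
        · obtain ⟨z, hzD, hzA, hyz⟩ := h1
          exact ⟨z, hzA, ⟨y, hyA, hyz.symm⟩, fun _ _ _ _ => ⟨hyz, hzD⟩,
            fun hyD w hw hyw => huniq hyD w z hw hzA hyw hyz⟩
        · push Not at h1
          by_cases h2 : ∃ z ∉ A, H.Adj y z
          · obtain ⟨z, hzA, hyz⟩ := h2
            exact ⟨z, hzA, ⟨y, hyA, hyz.symm⟩, fun w hw hwA hyw => absurd hyw (h1 w hw hwA),
              fun hyD w hw hyw => huniq hyD w z hw hzA hyw hyz⟩
          · push Not at h2
            obtain ⟨v, hv⟩ : ∃ v, v ∉ A := by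
              by_contra hcon
              push Not at hcon
              have := card_le_card (show (univ : Finset V) ⊆ A from fun v _ => hcon v)
              rw [card_univ] at this
              omega
            obtain ⟨w⟩ := hH.preconnected r v
            obtain ⟨d, -, hd1, hd2⟩ := w.exists_boundary_dart (A : Set V) hrA hv
            exact ⟨d.snd, hd2, ⟨d.fst, hd1, d.adj.symm⟩,
              fun w _ hwA hyw => absurd hyw (h2 w hwA), fun _ w hwA hyw => absurd hyw (h2 w hwA)⟩
      have hne : ∀ v ∈ A, v ≠ y' := fun v hv h => hy' (h ▸ hv)
      set n' := Function.update n y' (k + 1) with hn'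
      have hn1 : n' y' = k + 1 := by simp [hn']
      have hn2 : ∀ v ∈ A, n' v = n v := fun v hv => by simp [hn', hne v hv]
      refine ⟨insert y' A, y', n', ?_, mem_insert_self _ _, mem_insert_of_mem hrA, ?_, hn1,
        ?_, ?_, ?_, ?_, ?_, ?_⟩
      · rw [card_insert_of_notMem hy', hA]
      · rw [hn2 r hrA, hnr]
      · intro v hv w hw hvw
        simp only [coe_insert, Set.mem_insert_iff, mem_coe] at hv hw
        rcases hv with rfl | hv <;> rcases hw with rfl | hw
        · rfl
        · rw [hn1, hn2 w hw] at hvw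
          have := hle w hw
          omega
        · rw [hn1, hn2 v hv] at hvw
          have := hle v hv
          omega
        · rw [hn2 v hv, hn2 w hw] at hvw
          exact hinj hv hw hvw
      · intro v hv
        rcases mem_insert.1 hv with rfl | hv
        · exact hn1.le
        · rw [hn2 v hv]
          have := hle v hv
          omega
      · intro v hv hvr
        rcases mem_insert.1 hv with rfl | hv
        · refine ⟨u, mem_insert_of_mem huA, huy, ?_⟩
          rw [hn1, hn2 u huA]
          have := hle u huA
          omega
        · obtain ⟨u, hu, hvu, hlt⟩ := hpar v hv hvr
          exact ⟨u, mem_insert_of_mem hu, hvu, by rwa [hn2 u hu, hn2 v hv]⟩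
      · intro x hxD hx hxy z hxz
        rcases mem_insert.1 hx with rfl | hx
        · exact absurd rfl hxy
        by_cases hxy' : x = y
        · subst hxy'
          by_cases hz : z ∈ A
          · exact mem_insert_of_mem hz
          · rw [hyD' hxD z hz hxz]
            exact mem_insert_self _ _
        · exact mem_insert_of_mem (hcl x hxD hx hxy' z hxz)
      · intro x hxD hx z hz hxz hlt
        rcases mem_insert.1 hx with rfl | hxA
        · rcases mem_insert.1 hz with rfl | hz
          · omega
          · rw [hn1, hn2 z hz] at hlt
            have := hle z hz
            omega
        · rcases mem_insert.1 hz with rfl | hz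
          · have hxy : x = y := by
              by_contra hxy
              exact hy' (hcl x hxD hxA hxy _ hxz)
            rw [hn1, hn2 x hxA, hxy, hny]
          · rw [hn2 x hxA, hn2 z hz] at hlt ⊢
            exact hsucc x hxD hxA z hz hxz hlt
      · intro v hv hvy z hzD hvz hz
        rcases mem_insert.1 hv with rfl | hv
        · exact absurd rfl hvy
        have hz' : z ∉ A ∨ n v < n z := by
          by_cases hzA : z ∈ A
          · right
            rcases hz with hz | hz
            · exact absurd (mem_insert_of_mem hzA) hz
            · rwa [hn2 v hv, hn2 z hzA] at hz
          · exact Or.inl hzA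
        by_cases hvy' : v = y
        · subst hvy'
          have hzA : z ∉ A := by
            intro hzA
            rcases hz' with h | h
            · exact h hzA
            · have := hle z hzA
              omega
          obtain ⟨h1, h2⟩ := hyD z hzD hzA hvz
          exact ⟨y', h2, mem_insert_self _ _, h1, by rw [hn1, hn2 v hv, hny]⟩
        · obtain ⟨z', h1, h2, h3, h4⟩ := hD' v hv hvy' z hzD hvz hz'
          exact ⟨z', h1, mem_insert_of_mem h2, h3, by rw [hn2 z' h2, hn2 v hv, h4]⟩
  have hpos : 0 < Fintype.card V := Fintype.card_pos_iff.2 ⟨r⟩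
  obtain ⟨A, y, n, hA, -, -, hnr, hny, hinj, hle, hpar, -, hsucc, hD'⟩ :=
    key (Fintype.card V - 1) (by omega)
  have hAu : A = univ := by
    rw [← card_eq_iff_eq_univ]
    omega
  subst hAu
  refine ⟨n, fun v w h => hinj (by simp) (by simp) h, hnr, fun v hv => ?_,
    fun x hx z hxz hlt => hsucc x hx (mem_univ _) z (mem_univ _) hxz hlt,
    fun v z hz hvz hlt => ?_⟩
  · obtain ⟨u, -, h⟩ := hpar v (mem_univ _) hv
    exact ⟨u, h⟩
  · by_cases hvy : v = y
    · have := hle z (mem_univ _)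
      subst hvy
      omega
    · obtain ⟨z', h1, -, h2⟩ := hD' v (mem_univ _) hvy z hz hvz (Or.inr hlt)
      exact ⟨z', h1, h2⟩

theorem IsThreading.rotate {V E : Type*} [Finite V] {dd : Set V} {p q : V → E} {ν : V → ℕ}
    (hc : IsThreading dd p q ν) {a : V} (ha : a ∈ dd) (hpa : ∀ x ∈ dd, q x ≠ p a) :
    ∃ ν' : V → ℕ, IsThreading dd p q ν' ∧ (∀ x, ν a ≤ ν x → ∀ y, ν y < ν a → ν' x < ν' y) ∧
      (∀ x y, ν a ≤ ν x → ν x < ν y → ν' x < ν' y) ∧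
      (∀ x y, ν y < ν a → ν x < ν y → ν' x < ν' y) := by
  obtain ⟨N, hN⟩ := (Set.finite_range ν).bddAbove
  have hN : ∀ x, ν x ≤ N := fun x => hN ⟨x, rfl⟩
  refine ⟨fun x => if ν x < ν a then ν x + (N + 1) else ν x, { hc with ν_inj := ?_, succ := ?_ },
    ?_, ?_, ?_⟩
  · intro x hx y hy hxy
    have h1 := hN x
    have h2 := hN y
    simp only at hxy
    apply hc.ν_inj hx hy
    split_ifs at hxy <;> omega
  · intro x hx z hz hxz
    have h1 := hc.succ x hx z hz hxz
    have h2 : ν z ≠ ν a := fun h => hpa x hx (hc.ν_inj hz ha h ▸ hxz)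
    split_ifs <;> omega
  · intro x hx y hy
    have := hN x
    simp only
    split_ifs <;> omega
  · intro x y hx hy
    simp only
    split_ifs <;> omega
  · intro x y hx hy
    simp only
    split_ifs <;> omega

/-- Every vertex of `D` has exactly two neighbours `par x` and `oth x`, distinguished in a way that
is compatible with the order `n`. -/
structure IsOriented {V : Type*} (G : SimpleGraph V) (D : Set V) (n : V → ℕ) (par oth : V → V) :
    Prop where
  inj : Function.Injective n
  adj : ∀ x ∈ D, ∀ z, G.Adj x z ↔ z = par x ∨ z = oth x
  ne : ∀ x ∈ D, par x ≠ oth x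
  par_eq : ∀ x ∈ D, ∀ z ∈ D, G.Adj x z → n z < n x → par x = z
  par_lt : ∀ x ∈ D, par x ∈ D → n (par x) < n x
  succ : ∀ x ∈ D, n x < n (oth x) → n (oth x) = n x + 1

theorem IsOriented.isThreading {V : Type*} {G : SimpleGraph V} {D : Set V} {n : V → ℕ}
    {par oth : V → V} (ho : IsOriented G D n par oth) :
    IsThreading D (fun x => s(x, par x)) (fun x => s(x, oth x)) n where
  ne x hx h := by
    rcases Sym2.eq_iff.1 h with ⟨-, h⟩ | ⟨h, h'⟩
    · exact ho.ne x hx h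
    · exact ho.ne x hx (h'.trans h)
  p_inj x hx z hz h := by
    rcases Sym2.eq_iff.1 h with ⟨h, -⟩ | ⟨h, h'⟩
    · exact h
    · have h1 := ho.par_lt x hx (h' ▸ hz)
      have h2 := ho.par_lt z hz (h ▸ hx)
      rw [h'] at h1
      rw [← h] at h2
      omega
  q_inj x hx z hz h := by
    rcases Sym2.eq_iff.1 h with ⟨h, -⟩ | ⟨h, h'⟩
    · exact h
    · by_contra hne
      have hxz : G.Adj x z := (ho.adj x hx z).2 (Or.inr h'.symm)
      rcases lt_or_gt_of_ne (fun hn => hne (ho.inj hn)) with hlt | hlt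
      · exact ho.ne z hz ((ho.par_eq z hz x hx hxz.symm hlt).trans h)
      · exact ho.ne x hx ((ho.par_eq x hx z hz hxz hlt).trans h'.symm)
  ν_inj := ho.inj.injOn
  succ x hx z hz h := by
    rcases Sym2.eq_iff.1 h with ⟨h, h'⟩ | ⟨h, h'⟩
    · subst h
      exact absurd h'.symm (ho.ne x hx)
    · have h1 := ho.par_lt z hz (h ▸ hx)
      rw [← h, ← h'] at h1
      rw [← h']
      exact ho.succ x hx h1

theorem IsExploration.exists_isOriented {V : Type*} [Finite V] {G H : SimpleGraph V} {D : Set V}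
    {r : V} {n : V → ℕ} (hn : IsExploration H D r n) (hHG : H ≤ G)
    (hD : ∀ x ∈ D, ∃ y z, y ≠ z ∧ ∀ w, G.Adj x w ↔ w = y ∨ w = z)
    (hDH : ∀ x ∈ D, x ≠ r → ∀ z, G.Adj x z → H.Adj x z) (u : V)
    (hr : r ∈ D → u ∉ D ∧ G.Adj r u ∧ ∀ z, G.Adj r z → z ≠ u → H.Adj r z) :
    ∃ par oth, IsOriented G D n par oth ∧ (r ∈ D → par r = u) ∧
      ∀ x ∈ D, x ≠ r → n (par x) < n x ∧ ∀ z, G.Adj x z → n z < n x → n z ≤ n (par x) := by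
  have hpar : ∀ x ∈ D, ∃ v, G.Adj x v ∧ (x = r → v = u) ∧
      (x ≠ r → n v < n x ∧ ∀ z, G.Adj x z → n z < n x → n z ≤ n v) := by
    intro x hx
    by_cases hxr : x = r
    · subst hxr
      exact ⟨u, (hr hx).2.1, fun _ => rfl, fun h => absurd rfl h⟩
    · obtain ⟨w, hw1, hw2⟩ := hn.exists_lt x hxr
      obtain ⟨v, ⟨hv1, hv2⟩, hv3⟩ := Set.exists_max_image {z | G.Adj x z ∧ n z < n x} n
        (Set.toFinite _) ⟨w, hHG hw1, hw2⟩
      exact ⟨v, hv1, fun h => absurd h hxr, fun _ => ⟨hv2, fun z h1 h2 => hv3 z ⟨h1, h2⟩⟩⟩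
  have hall : ∀ x, ∃ v w, x ∈ D → (∀ z, G.Adj x z ↔ z = v ∨ z = w) ∧ v ≠ w ∧ (x = r → v = u) ∧
      (x ≠ r → n v < n x ∧ ∀ z, G.Adj x z → n z < n x → n z ≤ n v) := by
    intro x
    by_cases hx : x ∈ D
    · obtain ⟨v, hv1, hv2, hv3⟩ := hpar x hx
      obtain ⟨y, z, hyz, h⟩ := hD x hx
      rcases (h v).1 hv1 with rfl | rfl
      · exact ⟨v, z, fun _ => ⟨h, hyz, hv2, hv3⟩⟩
      · exact ⟨v, y, fun _ => ⟨fun w => by rw [h w, or_comm], hyz.symm, hv2, hv3⟩⟩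
    · exact ⟨x, x, fun h => absurd h hx⟩
  choose par oth h using hall
  have hroot : ∀ x, ¬ n x < n r := fun x => by rw [hn.root]; omega
  refine ⟨par, oth, ⟨hn.inj, fun x hx => (h x hx).1, fun x hx => (h x hx).2.1, ?_, ?_, ?_⟩,
    fun hr => (h r hr).2.2.1 rfl, fun x hx => (h x hx).2.2.2⟩
  · intro x hx z hz hxz hlt
    have hxr : x ≠ r := fun hc => hroot z (hc ▸ hlt)
    obtain ⟨h1, h2⟩ := (h x hx).2.2.2 hxr
    have h3 := h2 z hxz hlt
    have h4 := hn.succ z hz x (hDH x hx hxr z hxz).symm hlt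
    exact hn.inj (by omega)
  · intro x hx hp
    by_cases hxr : x = r
    · subst hxr
      rw [(h x hx).2.2.1 rfl] at hp
      exact absurd hp (hr hx).1
    · exact ((h x hx).2.2.2 hxr).1
  · intro x hx hlt
    have hadj : G.Adj x (oth x) := ((h x hx).1 _).2 (Or.inr rfl)
    refine hn.succ x hx _ ?_ hlt
    by_cases hxr : x = r
    · subst hxr
      refine (hr hx).2.2 _ hadj ?_
      rw [← (h x hx).2.2.1 rfl]
      exact (h x hx).2.1.symm
    · exact hDH x hx hxr _ hadj

/-- The vertices of a graph are split into leaves, vertices `D` with two neighbours, and vertices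
`Br` with more neighbours, one of which is the leaf `lf v`. -/
structure IsBranched {V : Type*} (G : SimpleGraph V) (Lf D Br : Set V) (nb lf : V → V) :
    Prop where
  cover : ∀ v, v ∈ Lf ∨ v ∈ D ∨ v ∈ Br
  leaf_adj : ∀ v ∈ Lf, ∀ u, G.Adj v u ↔ u = nb v
  nb_notMem : ∀ v ∈ Lf, nb v ∉ Lf
  thread_adj : ∀ x ∈ D, ∃ y z, y ≠ z ∧ ∀ w, G.Adj x w ↔ w = y ∨ w = z
  branch_adj : ∀ v ∈ Br, ∀ u w, ∃ z, G.Adj v z ∧ z ≠ u ∧ z ≠ w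
  lf_mem : ∀ v ∈ Br, lf v ∈ Lf
  nb_lf : ∀ v ∈ Br, nb (lf v) = v

section Branched

variable {V : Type*} {G : SimpleGraph V} {Lf D Br : Set V} {nb lf : V → V}

theorem IsBranched.leaf_notMem_thread (hb : IsBranched G Lf D Br nb lf) {v : V} (hv : v ∈ Lf) :
    v ∉ D := by
  intro hD
  obtain ⟨y, z, hyz, h⟩ := hb.thread_adj v hD
  have h1 := (hb.leaf_adj v hv y).1 ((h y).2 (Or.inl rfl))
  have h2 := (hb.leaf_adj v hv z).1 ((h z).2 (Or.inr rfl))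
  exact hyz (h1.trans h2.symm)

theorem IsBranched.leaf_notMem_branch (hb : IsBranched G Lf D Br nb lf) {v : V} (hv : v ∈ Lf) :
    v ∉ Br := by
  intro hB
  obtain ⟨z, hz, hz1, -⟩ := hb.branch_adj v hB (nb v) (nb v)
  exact hz1 ((hb.leaf_adj v hv z).1 hz)

theorem IsBranched.thread_notMem_branch (hb : IsBranched G Lf D Br nb lf) {v : V} (hv : v ∈ D) :
    v ∉ Br := by
  intro hB
  obtain ⟨y, z, hyz, h⟩ := hb.thread_adj v hv
  obtain ⟨w, hw, hw1, hw2⟩ := hb.branch_adj v hB y z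
  exact ((h w).1 hw).elim hw1 hw2

theorem IsBranched.adj_lf (hb : IsBranched G Lf D Br nb lf) {v : V} (hv : v ∈ Br) :
    G.Adj v (lf v) :=
  ((hb.leaf_adj _ (hb.lf_mem v hv) v).2 (hb.nb_lf v hv).symm).symm

/-- An edge at a leaf edge `s(v, lf v)` which contains a vertex that is no leaf contains `v`. -/
theorem IsBranched.eq_of_mem_lf (hb : IsBranched G Lf D Br nb lf) {v w : V}
    (hw : w ∉ Lf) (hv : v ∈ Br) (h : w ∈ s(v, lf v)) : w = v := by
  rcases Sym2.mem_iff.1 h with h | h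
  · exact h
  · exact absurd (h ▸ hb.lf_mem v hv) hw

end Branched

theorem mem_edgeFS {V : Type*} [Fintype V] {G : SimpleGraph V} {v w : V} :
    s(v, w) ∈ edgeFS G ↔ G.Adj v w := by
  simp [edgeFS]

open Finset in
/-- Sufficient conditions on the orientation of the threads for the existence of a labelling. -/
theorem IsBranched.exists_labelling {V : Type*} [Fintype V] {G : SimpleGraph V} {Lf D Br : Set V}
    {nb lf par oth : V → V} {n ν : V → ℕ} (hb : IsBranched G Lf D Br nb lf)
    (ho : IsOriented G D n par oth)
    (hc : IsThreading D (fun x => s(x, par x)) (fun x => s(x, oth x)) ν)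
    (X : Finset (Sym2 V)) (hXE : X ⊆ edgeFS G) (hXD : ∀ e ∈ X, ∀ x ∈ D, x ∉ e)
    (hXlf : ∀ v ∈ Br, s(v, lf v) ∉ X) (hX1 : ∀ v ∈ Lf, s(v, nb v) ∈ X → #X = 1)
    (a : V) (ha : D.Nonempty → a ∈ D ∧ ∀ x ∈ D, ν a ≤ ν x)
    (hleaf : ∀ x ∈ D, par x ∈ Lf → x ≠ a)
    (hbr : ∀ v ∈ Br, (∃ u, s(v, u) ∈ X) ∨ ∃ x ∈ D, oth x = v ∧ n v = n x + 1 ∧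
      ((∀ y ∈ D, ν y ≤ ν x) ∨ (par a ≠ v ∧ (oth a = v → a = x)))) :
    ∃ φ : Sym2 V → ℕ, Set.BijOn φ ↑(edgeFS G) ↑(Icc 1 #(edgeFS G)) ∧
      Function.Injective (fun v => ∏ e ∈ (edgeFS G).filter (fun e => v ∈ e), φ e) := by
  set p : V → Sym2 V := fun x => s(x, par x) with hp
  set q : V → Sym2 V := fun x => s(x, oth x) with hq
  obtain ⟨g, hg, hgβ⟩ := hc.exists_coloring
    (fun x => !decide (oth x ∈ Br ∧ n x < n (oth x)))
  let c : Sym2 V → ℕ := fun e => if e ∈ X then 4 else if ∃ v ∈ Br, e = s(v, lf v) then 2 else 1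
  have hc124 : ∀ e, c e = 4 ∧ e ∈ X ∨ c e = 2 ∧ (∃ v ∈ Br, e = s(v, lf v)) ∨ c e = 1 := by
    intro e
    simp only [c]
    split_ifs <;> simp_all
  have hc0 : ∀ e, c e ≠ 0 := fun e => by have := hc124 e; omega
  have hc3 : ∀ e, c e ≠ 3 := fun e => by have := hc124 e; omega
  let cls := chainCls D p q g c
  let key := chainKey D p q ν
  let sm := smallEdge p q g
  let lg := largeEdge p q g
  have hclsL : ∀ x ∈ D, cls (lg x) = 3 := fun x hx => chainCls_large hx
  have hclsS : ∀ x ∈ D, cls (sm x) = 0 := fun x hx => hc.cls_small hg hx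
  have hnm : ∀ e, (∀ x ∈ D, x ∉ e) → cls e = c e := by
    intro e he
    refine chainCls_of_not_mem fun x hx => ⟨?_, ?_⟩
    · rintro rfl
      exact he x hx (Sym2.mem_mk_left _ _)
    · rintro rfl
      exact he x hx (Sym2.mem_mk_left _ _)
  have hcls : ∀ e, cls e = 0 ∨ cls e = 3 ∨ cls e = c e := by
    intro e
    simp only [cls, chainCls]
    split_ifs <;> simp
  have hDlf : ∀ v ∈ Br, ∀ x ∈ D, x ∉ s(v, lf v) := by
    intro v hv x hx h
    have h1 := hb.eq_of_mem_lf (fun h => hb.leaf_notMem_thread h hx) hv h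
    exact hb.thread_notMem_branch hx (h1 ▸ hv)
  have hclsρ : ∀ v ∈ Br, cls s(v, lf v) = 2 := by
    intro v hv
    rw [hnm _ (hDlf v hv)]
    simp only [c]
    rw [if_neg (hXlf v hv), if_pos ⟨v, hv, rfl⟩]
  have hcls2 : ∀ e, cls e = 2 → ∃ v ∈ Br, e = s(v, lf v) := by
    intro e he
    rcases hcls e with h | h | h
    · omega
    · omega
    · rcases hc124 e with h1 | h1 | h1
      · omega
      · exact h1.2
      · omega
  have hclsX : ∀ e, e ∈ X ↔ 4 ≤ cls e := by
    intro e
    constructor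
    · intro he
      rw [hnm e (hXD e he)]
      simp [c, he]
    · intro he
      rcases hcls e with h | h | h
      · omega
      · omega
      · rcases hc124 e with h1 | h1 | h1
        · exact h1.2
        · omega
        · omega
  have hX : (edgeFS G).filter (fun e => 4 ≤ cls e) = X := by
    ext e
    rw [mem_filter, ← hclsX]
    exact ⟨And.right, fun h => ⟨hXE h, h⟩⟩
  have hpE : ∀ x ∈ D, p x ∈ edgeFS G := fun x hx =>
    mem_edgeFS.2 ((ho.adj x hx _).2 (Or.inl rfl))
  have hqE : ∀ x ∈ D, q x ∈ edgeFS G := fun x hx =>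
    mem_edgeFS.2 ((ho.adj x hx _).2 (Or.inr rfl))
  have hsmE : ∀ x ∈ D, sm x ∈ edgeFS G := by
    intro x hx
    rcases smallEdge_or p q g x with ⟨h, -⟩ | ⟨h, -⟩ <;> simp only [sm, h]
    exacts [hpE x hx, hqE x hx]
  -- the second edge of a thread vertex is the first edge of the other end, if that is in `D`
  have hfin : ∀ x ∈ D, oth x ∉ D → ∀ z ∈ D, q x ≠ p z := by
    intro x hx hox z hz h
    rcases Sym2.eq_iff.1 h with ⟨h1, h2⟩ | ⟨h1, h2⟩
    · subst h1
      exact ho.ne x hx h2.symm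
    · exact hox (h2 ▸ hz)
  -- a thread that ends in a branch vertex
  have hend : ∀ x ∈ D, oth x ∈ Br → n x < n (oth x) → g x = false := by
    intro x hx hB hlt
    rw [hgβ x hx (hfin x hx fun h => hb.thread_notMem_branch h hB)]
    simp [hB, hlt]
  have hρinj : ∀ v ∈ Br, ∀ w ∈ Br, s(v, lf v) = s(w, lf w) → v = w := by
    intro v hv w hw h
    refine hb.eq_of_mem_lf (fun h => hb.leaf_notMem_branch h hv) hw ?_
    rw [← h]
    exact Sym2.mem_mk_left _ _
  have hcount : #{e ∈ edgeFS G | cls e = 3} ≤ #{e ∈ edgeFS G | cls e < 3} := by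
    refine card_le_card_of_forall_subsingleton
      (fun e e' => ∃ x ∈ D, (e = p x ∧ e' = q x) ∨ (e = q x ∧ oth x ∈ Br ∧
        n (oth x) = n x + 1 ∧ e' = s(oth x, lf (oth x)))) ?_ ?_
    · intro e he
      obtain ⟨-, he⟩ := mem_filter.1 he
      obtain ⟨x, hx, rfl⟩ := exists_large_of_cls (hc3 e) he
      have hfst : ∀ x ∈ D, g x = true → ∃ e' ∈ {e ∈ edgeFS G | cls e < 3}, ∃ y ∈ D,
          (p x = p y ∧ e' = q y) ∨ (p x = q y ∧ oth y ∈ Br ∧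
          n (oth y) = n y + 1 ∧ e' = s(oth y, lf (oth y))) := by
        intro x hx hgx
        refine ⟨q x, mem_filter.2 ⟨hqE x hx, ?_⟩, x, hx, Or.inl ⟨rfl, rfl⟩⟩
        have h := hclsS x hx
        simp only [sm, smallEdge, hgx, if_true] at h
        omega
      cases hgx : g x
      · simp only [largeEdge, hgx, Bool.false_eq_true, if_false]
        by_cases hz : ∃ z ∈ D, q x = p z
        · obtain ⟨z, hz, hxz⟩ := hz
          rw [hxz]
          exact hfst z hz (by rw [hg x hx z hz hxz, hgx]; rfl)
        · push Not at hz
          have h := hgβ x hx hz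
          rw [hgx] at h
          obtain ⟨h1, h2⟩ : oth x ∈ Br ∧ n x < n (oth x) := by simpa using h.symm
          refine ⟨s(oth x, lf (oth x)), mem_filter.2 ⟨mem_edgeFS.2 (hb.adj_lf h1), ?_⟩, x, hx,
            Or.inr ⟨rfl, h1, ho.succ x hx h2, rfl⟩⟩
          rw [hclsρ _ h1]
          omega
      · simp only [largeEdge, hgx, if_true]
        exact hfst x hx hgx
    · rintro e' - e₁ ⟨-, x, hx, h1⟩ e₂ ⟨-, y, hy, h2⟩
      rcases h1 with ⟨rfl, h1⟩ | ⟨rfl, hB, hn, h1⟩ <;> rcases h2 with ⟨rfl, h2⟩ | ⟨rfl, hB', hn', h2⟩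
      · rw [hc.q_inj hx hy (h1.symm.trans h2)]
      · have h3 : q x = s(oth y, lf (oth y)) := h1.symm.trans h2
        refine absurd ?_ (hDlf _ hB' x hx)
        rw [← h3]
        exact Sym2.mem_mk_left _ _
      · have h3 : q y = s(oth x, lf (oth x)) := h2.symm.trans h1
        refine absurd ?_ (hDlf _ hB y hy)
        rw [← h3]
        exact Sym2.mem_mk_left _ _
      · have h3 := hρinj _ hB _ hB' (h1.symm.trans h2)
        rw [h3] at hn
        rw [ho.inj (show n x = n y by omega)]
  have hscheme : IsScheme (edgeFS G) (fun v => (edgeFS G).filter (fun e => v ∈ e)) Lf D Br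
      (fun v => s(v, nb v)) sm lg (fun v => s(v, lf v)) cls key := by
    refine ⟨hb.cover, fun v => filter_subset _ _, ?_, ?_, ?_, ?_, ?_, hclsS, hclsL, ?_, ?_, hclsρ,
      ?_, hρinj, ?_, hcount⟩
    · exact fun v hv => mem_edgeFS.2 ((hb.leaf_adj v hv _).2 rfl)
    · intro v hv
      left
      ext e
      rw [mem_filter, mem_singleton]
      constructor
      · rintro ⟨he, hve⟩
        obtain ⟨u, rfl⟩ := hve
        rw [(hb.leaf_adj v hv u).1 (mem_edgeFS.1 he)]
      · rintro rfl
        exact ⟨mem_edgeFS.2 ((hb.leaf_adj v hv _).2 rfl), Sym2.mem_mk_left _ _⟩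
    · intro v hv w hw h
      rcases Sym2.eq_iff.1 h with ⟨h, -⟩ | ⟨h, -⟩
      · exact h
      · exact absurd (h ▸ hv) (hb.nb_notMem w hw)
    · intro v hv
      rcases hcls s(v, nb v) with h | h | h
      · left; omega
      · right; left
        refine ⟨h, ?_⟩
        have hmem : ∀ y ∈ D, lg y = s(v, nb v) → y = nb v ∧ g y = true ∧ par y = v := by
          intro y hy hyv
          have hyv' : y ≠ v := fun h => hb.leaf_notMem_thread hv (h ▸ hy)
          cases hgy : g y
          · simp only [lg, largeEdge, hgy, Bool.false_eq_true, if_false] at hyv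
            rcases Sym2.eq_iff.1 hyv with ⟨h1, -⟩ | ⟨h1, h2⟩
            · exact absurd h1 hyv'
            · have h3 := hgβ y hy (hfin y hy (h2 ▸ hb.leaf_notMem_thread hv))
              rw [hgy] at h3
              obtain ⟨h4, -⟩ : oth y ∈ Br ∧ n y < n (oth y) := by simpa using h3.symm
              exact absurd (h2 ▸ h4) (hb.leaf_notMem_branch hv)
          · simp only [lg, largeEdge, hgy, if_true] at hyv
            rcases Sym2.eq_iff.1 hyv with ⟨h1, -⟩ | ⟨h1, h2⟩
            · exact absurd h1 hyv'
            · exact ⟨h1, rfl, h2⟩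
        intro x hx hxv
        obtain ⟨h1, h2, h3⟩ := hmem x hx hxv
        have hxa := hleaf x hx (h3 ▸ hv)
        obtain ⟨haD, hmin⟩ := ha ⟨x, hx⟩
        refine ⟨sm a, hsmE a haD, hclsS a haD, hc.small_min hc0 haD hmin (hclsS x hx) ?_⟩
        intro hsx
        have hsx' : q x = sm a := by
          rw [show sm a = sm x from hsx.symm]
          simp [sm, smallEdge, h2]
        have hne : ν a < ν x :=
          lt_of_le_of_ne (hmin x hx) fun h => hxa (hc.ν_inj haD hx h).symm
        rcases smallEdge_or p q g a with ⟨h4, -⟩ | ⟨h4, -⟩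
        · have := hc.succ x hx a haD (hsx'.trans h4)
          omega
        · exact hxa (hc.q_inj hx haD (hsx'.trans h4))
      · rcases hc124 s(v, nb v) with h1 | h1 | h1
        · right; right
          refine ⟨by omega, ?_⟩
          rw [hX]
          exact hX1 v hv h1.2
        · left; omega
        · left; omega
    · intro x hx
      have h1 : (edgeFS G).filter (fun e => x ∈ e) = {p x, q x} := by
        ext e
        simp only [mem_filter, mem_insert, mem_singleton]
        constructor
        · rintro ⟨he, u, rfl⟩
          rcases (ho.adj x hx u).1 (mem_edgeFS.1 he) with rfl | rfl
          · exact Or.inl rfl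
          · exact Or.inr rfl
        · rintro (rfl | rfl)
          · exact ⟨hpE x hx, Sym2.mem_mk_left _ _⟩
          · exact ⟨hqE x hx, Sym2.mem_mk_left _ _⟩
      change (edgeFS G).filter (fun e => x ∈ e) = _
      rw [h1]
      rcases smallEdge_or p q g x with ⟨h2, h3⟩ | ⟨h2, h3⟩ <;> ext e <;>
        simp only [sm, lg, h2, h3, mem_insert, mem_singleton]
      exact or_comm
    · intro x hx y hy hxy
      rcases lt_or_gt_of_ne (fun h => hxy (hc.ν_inj hx hy h)) with h | h
      · exact Or.inl (hc.comp hx hy h)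
      · exact Or.inr (hc.comp hy hx h)
    · exact fun v hv => mem_filter.2 ⟨mem_edgeFS.2 (hb.adj_lf hv), Sym2.mem_mk_left _ _⟩
    · intro v hv e he h2
      obtain ⟨w, hw, rfl⟩ := hcls2 e h2
      rw [hb.eq_of_mem_lf (fun h => hb.leaf_notMem_branch h hv) hw (mem_filter.1 he).2]
    · intro v hv
      rcases hbr v hv with ⟨u, hu⟩ | ⟨x, hx, hxv, hn, h⟩
      · left
        refine ⟨?_, s(v, u), mem_filter.2 ⟨hXE hu, Sym2.mem_mk_left _ _⟩, (hclsX _).1 hu⟩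
        have huE := mem_edgeFS.1 (hXE hu)
        obtain ⟨w, hw, hwu, -⟩ := hb.branch_adj v hv u u
        obtain ⟨z, hz, hzu, hzw⟩ := hb.branch_adj v hv u w
        have hsub : ({s(v, u), s(v, w), s(v, z)} : Finset (Sym2 V)) ⊆
            (edgeFS G).filter (fun e => v ∈ e) := by
          intro e he
          simp only [mem_insert, mem_singleton] at he
          rcases he with rfl | rfl | rfl
          · exact mem_filter.2 ⟨mem_edgeFS.2 huE, Sym2.mem_mk_left _ _⟩
          · exact mem_filter.2 ⟨mem_edgeFS.2 hw, Sym2.mem_mk_left _ _⟩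
          · exact mem_filter.2 ⟨mem_edgeFS.2 hz, Sym2.mem_mk_left _ _⟩
        refine le_trans (le_of_eq ?_) (card_le_card hsub)
        rw [card_eq_three.2 ⟨s(v, u), s(v, w), s(v, z), ?_, ?_, ?_, rfl⟩]
        · exact fun h => hwu (Sym2.congr_right.1 h).symm
        · exact fun h => hzu (Sym2.congr_right.1 h).symm
        · exact fun h => hzw (Sym2.congr_right.1 h).symm
      · right
        have hgx := hend x hx (hxv ▸ hv) (by rw [hxv]; omega)
        have hlx : lg x = q x := by simp [lg, largeEdge, hgx]
        have hqv : q x = s(v, x) := by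
          rw [← hxv]
          exact Sym2.eq_swap
        obtain ⟨haD, hmin⟩ := ha ⟨x, hx⟩
        refine ⟨q x, mem_filter.2 ⟨hqE x hx, hqv ▸ Sym2.mem_mk_left _ _⟩, hlx ▸ hclsL x hx,
          ⟨sm a, hsmE a haD, hclsS a haD⟩, ?_⟩
        rcases h with h | ⟨h1, h2⟩
        · left
          intro e' _ he' hne
          exact hc.snd_max hc3 hx h he' hne
        · right
          obtain ⟨u, hu, hux, hul⟩ := hb.branch_adj v hv x (lf v)
          refine ⟨s(v, u), mem_filter.2 ⟨mem_edgeFS.2 hu, Sym2.mem_mk_left _ _⟩, ?_, ?_, sm a,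
            hsmE a haD, hclsS a haD, ?_⟩
          · rw [hqv]
            exact fun h => hux (Sym2.congr_right.1 h)
          · intro hcl
            obtain ⟨w, hw, hw'⟩ := hcls2 _ hcl
            have hvw := hb.eq_of_mem_lf (fun h => hb.leaf_notMem_branch h hv) hw
              (hw' ▸ Sym2.mem_mk_left v u)
            subst hvw
            exact hul (Sym2.congr_right.1 hw')
          · by_cases h0 : cls s(v, u) = 0
            · right
              refine hc.small_min hc0 haD hmin h0 ?_
              intro hsa
              have hav : a ≠ v := fun h => hb.thread_notMem_branch haD (h ▸ hv)
              rcases smallEdge_or p q g a with ⟨h4, -⟩ | ⟨h4, -⟩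
              · rw [h4] at hsa
                rcases Sym2.eq_iff.1 hsa with ⟨h5, -⟩ | ⟨h5, -⟩
                · exact hav h5.symm
                · exact h1 h5.symm
              · rw [h4] at hsa
                rcases Sym2.eq_iff.1 hsa with ⟨h5, -⟩ | ⟨h5, h6⟩
                · exact hav h5.symm
                · exact hux (h6.trans (h2 h5.symm))
            · exact Or.inl h0
  exact hscheme.exists_labelling

/-- A leaf which is not the root is visited after its neighbour. -/
theorem IsBranched.nb_lt {V : Type*} {G : SimpleGraph V} {Lf D Br : Set V} {nb lf : V → V}
    (hb : IsBranched G Lf D Br nb lf) {H : SimpleGraph V} (hHG : H ≤ G)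
    {r : V} {n : V → ℕ} (hn : IsExploration H D r n) {v : V} (hv : v ∈ Lf) (hvr : v ≠ r) :
    n (nb v) < n v := by
  obtain ⟨u, hu, hlt⟩ := hn.exists_lt v hvr
  rwa [← (hb.leaf_adj v hv u).1 (hHG hu)]

/-- The graph stays connected when an edge is removed from the last vertex of an exploration that
is not a leaf. -/
theorem IsExploration.connected_deleteEdges {V : Type*} {G : SimpleGraph V} {D : Set V} {r : V} {n : V → ℕ}
    (hn : IsExploration G D r n) {y u t : V} (hyt : G.Adj y t) (htu : t ≠ u) (ht : n t < n y)
    (hu : n u < n y) : (G.deleteEdges {s(y, u)}).Connected := by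
  have hreach : ∀ k, ∀ v, n v = k → (G.deleteEdges {s(y, u)}).Reachable v r := by
    intro k
    induction k using Nat.strong_induction_on with
    | _ k ih =>
      intro v hv
      by_cases hvr : v = r
      · rw [hvr]
      obtain ⟨z, hvz, hlt⟩ : ∃ z, (G.deleteEdges {s(y, u)}).Adj v z ∧ n z < n v := by
        by_cases hvy : v = y
        · subst hvy
          refine ⟨t, ?_, ht⟩
          rw [SimpleGraph.deleteEdges_adj]
          exact ⟨hyt, fun h => htu (Sym2.congr_right.1 h)⟩
        · obtain ⟨z, hvz, hlt⟩ := hn.exists_lt v hvr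
          refine ⟨z, ?_, hlt⟩
          rw [SimpleGraph.deleteEdges_adj]
          refine ⟨hvz, fun h => ?_⟩
          rcases Sym2.eq_iff.1 h with ⟨h, -⟩ | ⟨rfl, rfl⟩
          · exact hvy h
          · omega
      exact hvz.reachable.trans (ih _ (hv ▸ hlt) z rfl)
  have : Nonempty V := ⟨r⟩
  exact ⟨fun v w => (hreach _ v rfl).trans (hreach _ w rfl).symm⟩

section Cases

variable {V : Type*} [Fintype V] {G : SimpleGraph V} {Lf D Br : Set V} {nb lf : V → V}

open Finset in
/-- The case in which there is a nonempty set `X` of edges to receive the largest labels. -/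
theorem IsBranched.exists_labelling_of_top (hb : IsBranched G Lf D Br nb lf) (hG : G.Connected)
    (X : Finset (Sym2 V)) (hXE : X ⊆ edgeFS G) (hXD : ∀ e ∈ X, ∀ x ∈ D, x ∉ e)
    (hXlf : ∀ v ∈ Br, s(v, lf v) ∉ X) (hX1 : ∀ v ∈ Lf, s(v, nb v) ∈ X → #X = 1)
    (r : V) (hr : r ∈ Br) (hrX : ∃ u, s(r, u) ∈ X)
    (hX : ∀ v ∈ Br, ∀ u ∈ Br, G.Adj v u → ∃ u, s(v, u) ∈ X) :
    ∃ φ : Sym2 V → ℕ, Set.BijOn φ ↑(edgeFS G) ↑(Icc 1 #(edgeFS G)) ∧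
      Function.Injective (fun v => ∏ e ∈ (edgeFS G).filter (fun e => v ∈ e), φ e) := by
  have hrD : r ∉ D := fun h => hb.thread_notMem_branch h hr
  have hrL : r ∉ Lf := fun h => hb.leaf_notMem_branch h hr
  obtain ⟨n, hn⟩ := exists_isExploration G hG D r
    (fun x hx u z w hu hz hw huz huw => by
      obtain ⟨y₁, y₂, -, h⟩ := hb.thread_adj x hx
      rw [h] at hu hz hw
      grind) (fun h => absurd h hrD)
  obtain ⟨par, oth, ho, -, hpar⟩ := hn.exists_isOriented le_rfl hb.thread_adj
    (fun _ _ _ _ h => h) r (fun h => absurd h hrD)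
  have hxr : ∀ x ∈ D, x ≠ r := fun x hx h => hrD (h ▸ hx)
  obtain ⟨a, ha⟩ : ∃ a, D.Nonempty → a ∈ D ∧ ∀ x ∈ D, n a ≤ n x := by
    by_cases hD : D.Nonempty
    · obtain ⟨a, ha, h⟩ := Set.exists_min_image D n (Set.toFinite _) hD
      exact ⟨a, fun _ => ⟨ha, h⟩⟩
    · exact ⟨r, fun h => absurd h hD⟩
  have hlfn : ∀ v ∈ Lf, n (nb v) < n v := fun v hv =>
    hb.nb_lt le_rfl hn hv (fun h => hrL (h ▸ hv))
  refine hb.exists_labelling ho ho.isThreading X hXE hXD hXlf hX1 a ha ?_ ?_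
  · intro x hx hp
    have h1 := hlfn _ hp
    have h2 := (hpar x hx (hxr x hx)).1
    rw [← (hb.leaf_adj _ hp x).1 ((ho.adj x hx _).2 (Or.inl rfl)).symm] at h1
    omega
  · intro v hv
    by_cases hvX : ∃ u, s(v, u) ∈ X
    · exact Or.inl hvX
    right
    have hvr : v ≠ r := by
      rintro rfl
      exact hvX hrX
    obtain ⟨u, hvu, hlt⟩ := hn.exists_lt v hvr
    rcases hb.cover u with hu | hu | hu
    · have h1 := hlfn u hu
      rw [← (hb.leaf_adj u hu v).1 hvu.symm] at h1
      omega
    · have h1 := hn.succ u hu v hvu.symm hlt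
      obtain ⟨haD, hmin⟩ := ha ⟨u, hu⟩
      refine ⟨u, hu, ?_, h1, Or.inr ⟨?_, ?_⟩⟩
      · rcases (ho.adj u hu v).1 hvu.symm with h | h
        · have h2 := (hpar u hu (hxr u hu)).1
          rw [← h] at h2
          omega
        · exact h.symm
      · intro h
        have h2 := (hpar a haD (hxr a haD)).1
        have h3 := hmin u hu
        rw [h] at h2
        omega
      · intro h
        have h3 := hmin u hu
        have h4 := ho.succ a haD (by rw [h]; omega)
        rw [h] at h4
        exact ho.inj (by omega)
    · exact absurd (hX v hv u hu hvu) hvX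

open Finset in
/-- The case in which all branch vertices are reached through threads, and the first of them is
immediately left through a thread. -/
theorem IsBranched.exists_labelling_of_first (hb : IsBranched G Lf D Br nb lf)
    {n : V → ℕ} {par oth : V → V} (ho : IsOriented G D n par oth)
    (hbr : ∀ v ∈ Br, ∃ x ∈ D, oth x = v ∧ n v = n x + 1) (w : V) (hw : w ∈ Br)
    (hmin : ∀ v ∈ Br, n w ≤ n v) (a : V) (ha : a ∈ D) (hpa : par a = w) (hna : n a = n w + 1) :
    ∃ φ : Sym2 V → ℕ, Set.BijOn φ ↑(edgeFS G) ↑(Icc 1 #(edgeFS G)) ∧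
      Function.Injective (fun v => ∏ e ∈ (edgeFS G).filter (fun e => v ∈ e), φ e) := by
  obtain ⟨ν, hc, h1, h2, h3⟩ := ho.isThreading.rotate ha (fun x hx h => by
    rcases Sym2.eq_iff.1 h with ⟨h1, h2⟩ | ⟨h1, -⟩
    · subst h1
      exact ho.ne x hx h2.symm
    · exact hb.thread_notMem_branch hx (by rwa [h1, hpa]))
  refine hb.exists_labelling ho hc ∅ (by simp) (by simp) (by simp) (by simp) a
    (fun _ => ⟨ha, fun x hx => ?_⟩) ?_ ?_
  · by_cases hxa : n x < n a
    · exact (h1 a le_rfl x hxa).le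
    · rcases eq_or_lt_of_le (not_lt.1 hxa) with h | h
      · rw [ho.inj h]
      · exact (h2 a x le_rfl h).le
  · rintro x hx hp rfl
    exact hb.leaf_notMem_branch (hpa ▸ hp) hw
  · intro v hv
    right
    obtain ⟨x, hx, hxv, hn⟩ := hbr v hv
    refine ⟨x, hx, hxv, hn, ?_⟩
    by_cases hvw : v = w
    · subst hvw
      left
      intro y hy
      by_cases hya : n y < n a
      · have hyv : n y ≠ n v := fun h => hb.thread_notMem_branch hy (ho.inj h ▸ hv)
        rcases eq_or_lt_of_le (show n y ≤ n x by omega) with h | h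
        · rw [ho.inj h]
        · exact (h3 y x (by omega) h).le
      · exact (h1 y (not_lt.1 hya) x (by omega)).le
    · refine Or.inr ⟨fun h => hvw (h.symm.trans hpa), fun h => ?_⟩
      have h4 := hmin v hv
      have h5 : n v ≠ n w := fun h => hvw (ho.inj h)
      have h6 : n v ≠ n a := fun h => hb.thread_notMem_branch ha (ho.inj h ▸ hv)
      have h7 := ho.succ a ha (by rw [h]; omega)
      rw [h] at h7
      exact ho.inj (by omega)

open Finset in
/-- The case in which some leaf is adjacent to a thread, and branch vertices are only adjacent to
threads and to a single leaf. -/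
theorem IsBranched.exists_labelling_of_leaf (hb : IsBranched G Lf D Br nb lf) (hG : G.Connected)
    (hB : Br.Nonempty) (hadj : ∀ v ∈ Br, ∀ u, G.Adj v u → u ∈ D ∨ u = lf v)
    (r : V) (hr : r ∈ Lf) (hrD : nb r ∈ D) :
    ∃ φ : Sym2 V → ℕ, Set.BijOn φ ↑(edgeFS G) ↑(Icc 1 #(edgeFS G)) ∧
      Function.Injective (fun v => ∏ e ∈ (edgeFS G).filter (fun e => v ∈ e), φ e) := by
  have hrD' : r ∉ D := hb.leaf_notMem_thread hr
  obtain ⟨n, hn⟩ := exists_isExploration G hG D r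
    (fun x hx u z w hu hz hw huz huw => by
      obtain ⟨y₁, y₂, -, h⟩ := hb.thread_adj x hx
      rw [h] at hu hz hw
      grind) (fun h => absurd h hrD')
  obtain ⟨par, oth, ho, -, hpar⟩ := hn.exists_isOriented le_rfl hb.thread_adj
    (fun _ _ _ _ h => h) r (fun h => absurd h hrD')
  have hbr : ∀ v ∈ Br, ∃ x ∈ D, G.Adj v x ∧ oth x = v ∧ n v = n x + 1 := by
    intro v hv
    obtain ⟨x, hvx, hlt⟩ := hn.exists_lt v (fun h => hb.leaf_notMem_branch hr (h ▸ hv))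
    rcases hadj v hv x hvx with hx | rfl
    · refine ⟨x, hx, hvx, ?_, hn.succ x hx v hvx.symm hlt⟩
      rcases (ho.adj x hx v).1 hvx.symm with h | h
      · have h2 := (hpar x hx (fun h => hrD' (h ▸ hx))).1
        rw [← h] at h2
        omega
      · exact h.symm
    · have h1 := hb.nb_lt le_rfl hn (hb.lf_mem v hv) (fun h => by
        have h2 := hb.nb_lf v hv
        rw [h] at h2
        exact hb.thread_notMem_branch hrD (h2 ▸ hv))
      rw [hb.nb_lf v hv] at h1
      omega
  obtain ⟨w, hw, hmin⟩ := Set.exists_min_image Br n (Set.toFinite _) hB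
  obtain ⟨x, hx, -, -, hwx⟩ := hbr w hw
  obtain ⟨z, hwz, hzx, hzl⟩ := hb.branch_adj w hw x (lf w)
  have hz : z ∈ D := (hadj w hw z hwz).resolve_right hzl
  have hlt : n w < n z := by
    by_contra hcon
    have h1 : n z ≠ n w := fun h => hwz.ne (ho.inj h.symm)
    have h2 := hn.succ z hz w hwz.symm (by omega)
    exact hzx (ho.inj (by omega))
  obtain ⟨a, ha, hwa, hna⟩ := hn.exists_succ w z hz hwz hlt
  obtain ⟨h1, h2⟩ := hpar a ha (fun h => hrD' (h ▸ ha))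
  have h3 := h2 w hwa.symm (by omega)
  exact hb.exists_labelling_of_first ho (fun v hv => by
    obtain ⟨x, hx, -, h⟩ := hbr v hv
    exact ⟨x, hx, h⟩) w hw hmin a ha (ho.inj (by omega)) hna

open Finset in
/-- The case in which branch vertices are only adjacent to threads and to a single leaf, and all
leaves are adjacent to branch vertices. -/
theorem IsBranched.exists_labelling_of_noLeaf (hb : IsBranched G Lf D Br nb lf)
    (hG : G.Connected) (hB : Br.Nonempty) (hadj : ∀ v ∈ Br, ∀ u, G.Adj v u → u ∈ D ∨ u = lf v)
    (hleaf : ∀ v ∈ Lf, nb v ∉ D) :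
    ∃ φ : Sym2 V → ℕ, Set.BijOn φ ↑(edgeFS G) ↑(Icc 1 #(edgeFS G)) ∧
      Function.Injective (fun v => ∏ e ∈ (edgeFS G).filter (fun e => v ∈ e), φ e) := by
  have hD2 : ∀ x ∈ D, ∀ u z w, G.Adj x u → G.Adj x z → G.Adj x w → u ≠ z → u ≠ w → z = w := by
    intro x hx u z w hu hz hw huz huw
    obtain ⟨y₁, y₂, -, h⟩ := hb.thread_adj x hx
    rw [h] at hu hz hw
    grind
  have hDL : ∀ x ∈ D, ∀ z, G.Adj x z → z ∉ Lf := by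
    intro x hx z hxz hz
    have := (hb.leaf_adj z hz x).1 hxz.symm
    exact hleaf z hz (this ▸ hx)
  obtain ⟨y, u, t, hy, hu, hyu, hyt, htu, hH⟩ : ∃ y u t, y ∈ D ∧ u ∈ Br ∧ G.Adj y u ∧
      (∀ z, G.Adj y z → z ≠ u → z = t) ∧ t ≠ u ∧ (G.deleteEdges {s(y, u)}).Connected := by
    obtain ⟨r, hr⟩ := hB
    obtain ⟨n, hn⟩ := exists_isExploration G hG D r hD2
      (fun h => absurd hr (hb.thread_notMem_branch h))
    obtain ⟨y, hyL, hmax⟩ := Set.exists_max_image {v | v ∉ Lf} n (Set.toFinite _)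
      ⟨r, fun h => hb.leaf_notMem_branch h hr⟩
    have hlt : ∀ z, G.Adj y z → z ∉ Lf → n z < n y := fun z hyz hz =>
      lt_of_le_of_ne (hmax z hz) (fun h => hyz.ne (hn.inj h.symm))
    have hyD : y ∈ D := by
      rcases hb.cover y with h | h | h
      · exact absurd h hyL
      · exact h
      · exfalso
        obtain ⟨z₁, hz₁, hne₁, -⟩ := hb.branch_adj y h (lf y) (lf y)
        obtain ⟨z₂, hz₂, hne₂, hne₂'⟩ := hb.branch_adj y h (lf y) z₁
        have hD₁ := (hadj y h z₁ hz₁).resolve_right hne₁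
        have hD₂ := (hadj y h z₂ hz₂).resolve_right hne₂
        have h1 := hn.succ z₁ hD₁ y hz₁.symm (hlt z₁ hz₁ fun h => hb.leaf_notMem_thread h hD₁)
        have h2 := hn.succ z₂ hD₂ y hz₂.symm (hlt z₂ hz₂ fun h => hb.leaf_notMem_thread h hD₂)
        exact hne₂' (hn.inj (by omega))
    obtain ⟨s, t, hst, h⟩ := hb.thread_adj y hyD
    have hys : G.Adj y s := (h s).2 (Or.inl rfl)
    have hyt : G.Adj y t := (h t).2 (Or.inr rfl)
    have hs := hlt s hys (hDL y hyD s hys)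
    have ht := hlt t hyt (hDL y hyD t hyt)
    by_cases hsD : s ∈ D
    · have htD : t ∉ D := by
        intro htD
        have h1 := hn.succ s hsD y hys.symm hs
        have h2 := hn.succ t htD y hyt.symm ht
        exact hst (hn.inj (by omega))
      refine ⟨y, t, s, hyD, ?_, hyt, ?_, hst, hn.connected_deleteEdges hys hst hs ht⟩
      · have := hb.cover t
        have := hDL y hyD t hyt
        tauto
      · intro z hz hne
        exact ((h z).1 hz).resolve_right hne
    · refine ⟨y, s, t, hyD, ?_, hys, ?_, hst.symm, hn.connected_deleteEdges hyt hst.symm ht hs⟩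
      · have := hb.cover s
        have := hDL y hyD s hys
        tauto
      · intro z hz hne
        exact ((h z).1 hz).resolve_left hne
  set H := G.deleteEdges {s(y, u)} with hHdef
  have hHG : H ≤ G := G.deleteEdges_le _
  have hHadj : ∀ v w, H.Adj v w ↔ G.Adj v w ∧ s(v, w) ≠ s(y, u) := by
    intro v w
    rw [hHdef, SimpleGraph.deleteEdges_adj, Set.mem_singleton_iff]
  have huD : u ∉ D := fun h => hb.thread_notMem_branch h hu
  have hyL : y ∉ Lf := fun h => hb.leaf_notMem_thread h hy
  have hDH : ∀ x ∈ D, x ≠ y → ∀ z, G.Adj x z → H.Adj x z := by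
    intro x hx hxy z hxz
    refine (hHadj x z).2 ⟨hxz, fun h => ?_⟩
    rcases Sym2.eq_iff.1 h with ⟨h, -⟩ | ⟨h, -⟩
    · exact hxy h
    · exact huD (h ▸ hx)
  have hyH : ∀ z, H.Adj y z → z = t := fun z hz =>
    hyt z (hHG hz) (fun h => ((hHadj y z).1 hz).2 (by rw [h]))
  obtain ⟨n, hn⟩ := exists_isExploration H hH D y
    (fun x hx u z w hu hz hw => hD2 x hx u z w (hHG hu) (hHG hz) (hHG hw))
    (fun _ z w hz hw => (hyH z hz).trans (hyH w hw).symm)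
  obtain ⟨par, oth, ho, hpy, hpar⟩ := hn.exists_isOriented hHG hb.thread_adj hDH u
    (fun _ => ⟨huD, hyu, fun z hz hzu => (hHadj y z).2 ⟨hz, fun h => hzu (Sym2.congr_right.1 h)⟩⟩)
  have hpy := hpy hy
  have hlfn : ∀ v ∈ Lf, n (nb v) < n v := fun v hv => hb.nb_lt hHG hn hv (fun h => hyL (h ▸ hv))
  have hbr : ∀ v ∈ Br, ∃ x ∈ D, H.Adj v x ∧ oth x = v ∧ n v = n x + 1 := by
    intro v hv
    obtain ⟨x, hvx, hlt⟩ := hn.exists_lt v (fun h => hb.thread_notMem_branch hy (h ▸ hv))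
    rcases hadj v hv x (hHG hvx) with hx | rfl
    · refine ⟨x, hx, hvx, ?_, hn.succ x hx v hvx.symm hlt⟩
      rcases (ho.adj x hx v).1 (hHG hvx.symm) with h | h
      · by_cases hxy : x = y
        · subst hxy
          exact absurd (by rw [h, hpy]) ((hHadj x v).1 hvx.symm).2
        · have h2 := (hpar x hx hxy).1
          rw [← h] at h2
          omega
      · exact h.symm
    · have h1 := hlfn _ (hb.lf_mem v hv)
      rw [hb.nb_lf v hv] at h1
      omega
  obtain ⟨w, hw, hmin⟩ := Set.exists_min_image Br n (Set.toFinite _) hB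
  obtain ⟨x, hx, hwx, hxw, hnwx⟩ := hbr w hw
  by_cases hz : ∃ z ∈ D, H.Adj w z ∧ z ≠ x
  · obtain ⟨z, hz, hwz, hzx⟩ := hz
    have hlt : n w < n z := by
      by_contra hcon
      have h1 : n z ≠ n w := fun h => hwz.ne (ho.inj h.symm)
      have h2 := hn.succ z hz w hwz.symm (by omega)
      exact hzx (ho.inj (by omega))
    obtain ⟨a, ha, hwa, hna⟩ := hn.exists_succ w z hz hwz hlt
    have hay : a ≠ y := by
      rintro rfl
      rw [hn.root] at hna
      omega
    obtain ⟨h1, h2⟩ := hpar a ha hay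
    have h3 := h2 w (hHG hwa.symm) (by omega)
    exact hb.exists_labelling_of_first ho (fun v hv => by
      obtain ⟨x, hx, -, h⟩ := hbr v hv
      exact ⟨x, hx, h⟩) w hw hmin a ha (ho.inj (by omega)) hna
  · push Not at hz
    -- everything but leaves is visited before `w`
    have hlast : ∀ z, z ∉ Lf → n z ≤ n w := by
      by_contra hcon
      push Not at hcon
      obtain ⟨z, ⟨hzL, hzw⟩, hzmin⟩ := Set.exists_min_image {z | z ∉ Lf ∧ n w < n z} n
        (Set.toFinite _) hcon
      obtain ⟨v, hzv, hlt⟩ := hn.exists_lt z (fun h => by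
        rw [h, hn.root] at hzw
        omega)
      have hvL : v ∉ Lf := by
        intro hv
        have h1 := hlfn v hv
        rw [← (hb.leaf_adj v hv z).1 (hHG hzv).symm] at h1
        omega
      have hvw : n v ≤ n w := by
        by_contra hcon
        have := hzmin v ⟨hvL, by omega⟩
        omega
      rcases hb.cover v with hv | hv | hv
      · exact hvL hv
      · have := hn.succ v hv z hzv.symm hlt
        have : n v ≠ n w := fun h => hb.thread_notMem_branch hv (ho.inj h ▸ hw)
        omega
      · have hvw : v = w := ho.inj (le_antisymm hvw (hmin v hv))
        subst hvw
        rcases hadj v hv z (hHG hzv).symm with hzD | rfl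
        · rw [hz z hzD hzv.symm] at hzw
          omega
        · exact hzL (hb.lf_mem v hv)
    have hxmax : ∀ z ∈ D, n z ≤ n x := by
      intro z hzD
      have h1 := hlast z (fun h => hb.leaf_notMem_thread h hzD)
      have h2 : n z ≠ n w := fun h => hb.thread_notMem_branch hzD (ho.inj h ▸ hw)
      omega
    refine hb.exists_labelling ho ho.isThreading ∅ (by simp) (by simp) (by simp) (by simp) y
      (fun _ => ⟨hy, fun x _ => by rw [hn.root]; omega⟩) ?_ ?_
    · rintro x hx hp rfl
      exact hb.leaf_notMem_branch (hpy ▸ hp) hu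
    · intro v hv
      obtain ⟨z, hz, -, hzv, hnz⟩ := hbr v hv
      have h1 := hmin v hv
      have h2 := hxmax z hz
      refine Or.inr ⟨x, hx, ?_, by omega, Or.inl hxmax⟩
      rw [hxw]
      exact ho.inj (by omega)

open Finset in
/-- Every connected graph with branch vertices, all of which support a leaf, has a labelling. -/
theorem IsBranched.exists_labelling_of_connected (hb : IsBranched G Lf D Br nb lf)
    (hG : G.Connected) (hB : Br.Nonempty) :
    ∃ φ : Sym2 V → ℕ, Set.BijOn φ ↑(edgeFS G) ↑(Icc 1 #(edgeFS G)) ∧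
      Function.Injective (fun v => ∏ e ∈ (edgeFS G).filter (fun e => v ∈ e), φ e) := by
  by_cases h1 : ∃ r ∈ Br, ∃ t ∈ Br, G.Adj r t
  · obtain ⟨r, hr, t, ht, hrt⟩ := h1
    have hmem : ∀ v w, s(v, w) ∈ (edgeFS G).filter (fun e => ∀ v ∈ e, v ∈ Br) ↔
        G.Adj v w ∧ v ∈ Br ∧ w ∈ Br := by
      intro v w
      rw [mem_filter, mem_edgeFS]
      simp
    refine hb.exists_labelling_of_top hG ((edgeFS G).filter (fun e => ∀ v ∈ e, v ∈ Br))
      (filter_subset _ _) ?_ ?_ ?_ r hr ⟨t, (hmem r t).2 ⟨hrt, hr, ht⟩⟩ ?_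
    · intro e he x hx hxe
      exact hb.thread_notMem_branch hx ((mem_filter.1 he).2 x hxe)
    · intro v hv h
      exact hb.leaf_notMem_branch (hb.lf_mem v hv) ((hmem _ _).1 h).2.2
    · intro v hv h
      exact absurd ((hmem _ _).1 h).2.1 (hb.leaf_notMem_branch hv)
    · intro v hv u hu hvu
      exact ⟨u, (hmem v u).2 ⟨hvu, hv, hu⟩⟩
  push Not at h1
  by_cases h2 : ∃ r ∈ Br, ∃ t ∈ Lf, G.Adj r t ∧ t ≠ lf r
  · obtain ⟨r, hr, t, ht, hrt, hne⟩ := h2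
    refine hb.exists_labelling_of_top hG {s(r, t)} ?_ ?_ ?_ ?_ r hr ⟨t, by simp⟩ ?_
    · intro e he
      rw [mem_singleton.1 he]
      exact mem_edgeFS.2 hrt
    · intro e he x hx hxe
      rw [mem_singleton.1 he] at hxe
      rcases Sym2.mem_iff.1 hxe with rfl | rfl
      · exact hb.thread_notMem_branch hx hr
      · exact hb.leaf_notMem_thread ht hx
    · intro v hv h
      have h3 := mem_singleton.1 h
      have h4 := hb.eq_of_mem_lf (fun h => hb.leaf_notMem_branch h hr) hv
        (h3 ▸ Sym2.mem_mk_left r t)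
      subst h4
      exact hne (Sym2.congr_right.1 h3).symm
    · simp
    · exact fun v hv u hu hvu => absurd hvu (h1 v hv u hu)
  push Not at h2
  have hadj : ∀ v ∈ Br, ∀ u, G.Adj v u → u ∈ D ∨ u = lf v := by
    intro v hv u hvu
    rcases hb.cover u with hu | hu | hu
    · exact Or.inr (h2 v hv u hu hvu)
    · exact Or.inl hu
    · exact absurd hvu (h1 v hv u hu)
  by_cases h3 : ∃ r ∈ Lf, nb r ∈ D
  · obtain ⟨r, hr, hrD⟩ := h3
    exact hb.exists_labelling_of_leaf hG hB hadj r hr hrD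
  · push Not at h3
    exact hb.exists_labelling_of_noLeaf hG hB hadj h3

end Cases

open Finset in
/-- Paths and cycles with at least three edges have a labelling.  Here `r` is an end of the path,
or an arbitrary vertex of the cycle, and `D` consists of the other vertices with two neighbours. -/
theorem exists_labelling_of_path_or_cycle {V : Type*} [Fintype V] {G : SimpleGraph V}
    (hG : G.Connected) {Lf D : Set V} {nb : V → V} {r s t : V}
    (hcover : ∀ v, v = r ∨ v ∈ D ∨ v ∈ Lf) (hrD : r ∉ D) (hrL : r ∉ Lf)
    (hLf : ∀ v ∈ Lf, ∀ u, G.Adj v u ↔ u = nb v) (hnb : ∀ v ∈ Lf, nb v ∈ D)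
    (hD : ∀ x ∈ D, ∃ y z, y ≠ z ∧ ∀ w, G.Adj x w ↔ w = y ∨ w = z)
    (hs : s ∈ D) (ht : t ∈ D) (hadj : ∀ u, G.Adj r u ↔ u = s ∨ u = t)
    (hst : (s = t ∧ ∀ v ∈ Lf, nb v ≠ s) ∨ (s ≠ t ∧ Lf = ∅)) :
    ∃ φ : Sym2 V → ℕ, Set.BijOn φ ↑(edgeFS G) ↑(Icc 1 #(edgeFS G)) ∧
      Function.Injective (fun v => ∏ e ∈ (edgeFS G).filter (fun e => v ∈ e), φ e) := by
  obtain ⟨n, hn⟩ := exists_isExploration G hG D r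
    (fun x hx u z w hu hz hw huz huw => by
      obtain ⟨y₁, y₂, -, h⟩ := hD x hx
      rw [h] at hu hz hw
      grind) (fun h => absurd h hrD)
  obtain ⟨par, oth, ho, -, hpar⟩ := hn.exists_isOriented le_rfl hD
    (fun _ _ _ _ h => h) r (fun h => absurd h hrD)
  have hxr : ∀ x ∈ D, x ≠ r := fun x hx h => hrD (h ▸ hx)
  have hpar1 : ∀ x ∈ D, n (par x) < n x := fun x hx => (hpar x hx (hxr x hx)).1
  have hpE : ∀ x ∈ D, G.Adj x (par x) := fun x hx => (ho.adj x hx _).2 (Or.inl rfl)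
  have hqE : ∀ x ∈ D, G.Adj x (oth x) := fun x hx => (ho.adj x hx _).2 (Or.inr rfl)
  have hLD : ∀ v ∈ Lf, v ∉ D := by
    intro v hv hvD
    have h1 := (hLf v hv _).1 (hpE v hvD)
    have h2 := (hLf v hv _).1 (hqE v hvD)
    exact ho.ne v hvD (h1.trans h2.symm)
  have hparL : ∀ x ∈ D, par x ∉ Lf := by
    intro x hx hp
    obtain ⟨u, hu, hlt⟩ := hn.exists_lt (par x) (fun h => hrL (h ▸ hp))
    have h1 := (hLf _ hp _).1 (hpE x hx).symm
    rw [(hLf _ hp u).1 hu, ← h1] at hlt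
    have := hpar1 x hx
    omega
  obtain ⟨a, ha, hmin⟩ := Set.exists_min_image D n (Set.toFinite _) ⟨s, hs⟩
  have hpa : par a = r := by
    rcases hcover (par a) with h | h | h
    · exact h
    · have := hmin _ h
      have := hpar1 a ha
      omega
    · exact absurd h (hparL a ha)
  obtain ⟨b, hbD, hadj, hab⟩ : ∃ b ∈ D, (∀ u, G.Adj r u ↔ u = a ∨ u = b) ∧
      ((a = b ∧ ∀ v ∈ Lf, nb v ≠ a) ∨ (a ≠ b ∧ Lf = ∅)) := by
    have hra : G.Adj r a := hpa ▸ (hpE a ha).symm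
    rcases (hadj a).1 hra with rfl | rfl
    · exact ⟨t, ht, hadj, hst⟩
    · refine ⟨s, hs, fun u => by rw [hadj u, or_comm], ?_⟩
      rcases hst with ⟨rfl, h⟩ | ⟨h, h'⟩
      · exact Or.inl ⟨rfl, h⟩
      · exact Or.inr ⟨h.symm, h'⟩
  have hpr : ∀ z ∈ D, z ≠ a → par z ≠ r := by
    intro z hz hza hpz
    have hzb : z = b := ((hadj z).1 (hpz ▸ (hpE z hz).symm)).resolve_left hza
    obtain ⟨-, hL⟩ : a ≠ b ∧ Lf = ∅ := hab.resolve_left fun h => hza (hzb.trans h.1.symm)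
    have haz : n a < n z := lt_of_le_of_ne (hmin z hz) (fun h => hza (ho.inj h.symm))
    obtain ⟨c, ⟨hc, hcz⟩, hmax⟩ := Set.exists_max_image {c | c ∈ D ∧ n c < n z} n
      (Set.toFinite _) ⟨a, ha, haz⟩
    rcases lt_or_ge (n c) (n (oth c)) with h | h
    · have h1 := ho.succ c hc h
      have h2 : oth c ∈ D := by
        rcases hcover (oth c) with h2 | h2 | h2
        · rw [h2, hn.root] at h
          omega
        · exact h2
        · simp [hL] at h2
      have h3 : ¬ n (oth c) < n z := by
        intro h3
        have := hmax _ ⟨h2, h3⟩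
        omega
      have h4 : oth c = z := ho.inj (by omega)
      have h5 := (hpar z hz (hxr z hz)).2 c (h4 ▸ (hqE c hc).symm) hcz
      rw [hpz, hn.root] at h5
      have := hpar1 c hc
      omega
    · have h1 : n (oth c) < n c := lt_of_le_of_ne h fun h => (hqE c hc).ne (ho.inj h.symm)
      rcases hcover (oth c) with h2 | h2 | h2
      · have h3 : c = a ∨ c = b := (hadj c).1 (h2 ▸ (hqE c hc).symm)
        rcases h3 with rfl | h3
        · exact ho.ne c hc (hpa.trans h2.symm)
        · rw [h3, hzb] at hcz
          omega
      · exact ho.ne c hc (ho.par_eq c hc _ h2 (hqE c hc) h1)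
      · simp [hL] at h2
  have hpred : ∀ z ∈ D, z ≠ a → ∃ c ∈ D, s(c, oth c) = s(z, par z) := by
    intro z hz hza
    have hpD : par z ∈ D := by
      rcases hcover (par z) with h | h | h
      · exact absurd h (hpr z hz hza)
      · exact h
      · exact absurd h (hparL z hz)
    refine ⟨par z, hpD, ?_⟩
    rcases (ho.adj _ hpD z).1 (hpE z hz).symm with h | h
    · have h1 := hpar1 _ hpD
      have h2 := hpar1 z hz
      rw [← h] at h1
      omega
    · rw [← h, Sym2.eq_swap]
  have hc := ho.isThreading
  set p : V → Sym2 V := fun x => s(x, par x) with hp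
  set q : V → Sym2 V := fun x => s(x, oth x) with hq
  obtain ⟨g, hg, hga⟩ : ∃ g : V → Bool, (∀ x ∈ D, ∀ z ∈ D, q x = p z → g z = !g x) ∧
      g a = false := by
    obtain ⟨g, hg, -⟩ := hc.exists_coloring (fun _ => false)
    cases h : g a
    · exact ⟨g, hg, h⟩
    · exact ⟨fun x => !g x, fun x hx z hz hxz => by simp [hg x hx z hz hxz], by simp [h]⟩
  let cls := chainCls D p q g (fun _ => 1)
  let key := chainKey D p q n
  let sm := smallEdge p q g
  let lg := largeEdge p q g
  have hclsL : ∀ x ∈ D, cls (lg x) = 3 := fun x hx => chainCls_large hx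
  have hclsS : ∀ x ∈ D, cls (sm x) = 0 := fun x hx => hc.cls_small hg hx
  have hcls : ∀ e, cls e = 0 ∨ cls e = 3 ∨ cls e = 1 := by
    intro e
    simp only [cls, chainCls]
    split_ifs <;> simp
  have hsma : sm a = s(r, a) := by
    simp only [sm, smallEdge, hga, Bool.false_eq_true, if_false, hp, hpa]
    exact Sym2.eq_swap
  have hsm : ∀ x, x ∈ sm x := by
    intro x
    rcases smallEdge_or p q g x with ⟨h, -⟩ | ⟨h, -⟩ <;> simp only [sm, h] <;>
      exact Sym2.mem_mk_left _ _
  have hlg : ∀ x, x ∈ lg x := by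
    intro x
    rcases smallEdge_or p q g x with ⟨-, h⟩ | ⟨-, h⟩ <;> simp only [lg, h] <;>
      exact Sym2.mem_mk_left _ _
  have hra : G.Adj r a := (hadj a).2 (Or.inl rfl)
  have hmin' : ∀ e, cls e = 0 → e ≠ sm a → key (sm a) < key e := fun e he hne =>
    hc.small_min (fun _ => one_ne_zero) ha hmin he hne
  have hcount : #{e ∈ edgeFS G | cls e = 3} ≤ #{e ∈ edgeFS G | cls e < 3} := by
    refine card_le_card_of_forall_subsingleton (fun e e' => ∃ x ∈ D, e = q x ∧ e' = p x) ?_ ?_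
    · intro e he
      obtain ⟨-, he⟩ := mem_filter.1 he
      obtain ⟨x, hx, rfl⟩ := exists_large_of_cls (by norm_num) he
      obtain ⟨y, hy, hgy, hxy⟩ : ∃ y ∈ D, g y = false ∧ largeEdge p q g x = q y := by
        cases hgx : g x
        · exact ⟨x, hx, hgx, by simp [largeEdge, hgx]⟩
        · obtain ⟨c, hcD, h⟩ := hpred x hx (fun h => by simp [h, hga] at hgx)
          refine ⟨c, hcD, ?_, by simp only [largeEdge, hgx, if_true]; exact h.symm⟩
          have := hg c hcD x hx h
          rw [hgx] at this
          simpa using this.symm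
      refine ⟨p y, mem_filter.2 ⟨mem_edgeFS.2 (hpE y hy), ?_⟩, y, hy, hxy, rfl⟩
      have h := hclsS y hy
      simp only [sm, smallEdge, hgy, Bool.false_eq_true, if_false] at h
      omega
    · rintro e' - e₁ ⟨-, x, hx, rfl, h1⟩ e₂ ⟨-, y, hy, rfl, h2⟩
      rw [hc.p_inj hx hy (h1.symm.trans h2)]
  let ε : V → Sym2 V := fun v => if v = r then s(r, b) else s(v, nb v)
  have hεr : ε r = s(r, b) := if_pos rfl
  have hεL : ∀ v ∈ Lf, ε v = s(v, nb v) := fun v hv => by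
    simp only [ε]
    rw [if_neg]
    rintro rfl
    exact hrL hv
  have hinc : ∀ v u w, (∀ z, G.Adj v z ↔ z = u ∨ z = w) →
      (edgeFS G).filter (fun e => v ∈ e) = {s(v, u), s(v, w)} := by
    intro v u w h
    ext e
    simp only [mem_filter, mem_insert, mem_singleton]
    constructor
    · rintro ⟨he, z, rfl⟩
      rcases (h z).1 (mem_edgeFS.1 he) with rfl | rfl
      · exact Or.inl rfl
      · exact Or.inr rfl
    · rintro (rfl | rfl)
      · exact ⟨mem_edgeFS.2 ((h u).2 (Or.inl rfl)), Sym2.mem_mk_left _ _⟩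
      · exact ⟨mem_edgeFS.2 ((h w).2 (Or.inr rfl)), Sym2.mem_mk_left _ _⟩
  have hscheme : IsScheme (edgeFS G) (fun v => (edgeFS G).filter (fun e => v ∈ e))
      (insert r Lf) D ∅ ε sm lg (fun v => s(v, v)) cls key := by
    refine ⟨?_, fun v => filter_subset _ _, ?_, ?_, ?_, ?_, ?_, hclsS, hclsL, ?_, by simp, by simp,
      by simp, by simp, by simp, hcount⟩
    · intro v
      have := hcover v
      simp only [Set.mem_insert_iff, Set.mem_empty_iff_false]
      tauto
    · rintro v (rfl | hv)
      · rw [hεr]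
        exact mem_edgeFS.2 ((hadj b).2 (Or.inr rfl))
      · rw [hεL v hv]
        exact mem_edgeFS.2 ((hLf v hv _).2 rfl)
    · rintro v (rfl | hv)
      · rw [hεr]
        rw [hinc v a b hadj]
        rcases hab with ⟨rfl, -⟩ | ⟨hab, -⟩
        · left
          simp
        · right
          refine ⟨sm a, hsma ▸ mem_edgeFS.2 hra, ?_, ?_, hclsS a ha, ?_⟩
          · rw [hsma]
            exact fun h => hab (Sym2.congr_right.1 h)
          · rw [hsma]
            ext e
            simp only [mem_insert, mem_singleton]
            exact or_comm
          · intro e _ hne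
            have h0 := hclsS a ha
            by_cases he : cls e = 0
            · exact Or.inr ⟨by omega, hmin' e he hne⟩
            · left
              omega
      · left
        rw [hεL v hv]
        rw [hinc v (nb v) (nb v) (fun z => by rw [hLf v hv, or_self])]
        simp
    · have h1 : ∀ w ∈ Lf, s(r, b) ≠ s(w, nb w) := by
        intro w hw h
        rcases Sym2.eq_iff.1 h with ⟨h, -⟩ | ⟨h, -⟩
        · exact hrL (h ▸ hw)
        · exact hrD (h ▸ hnb w hw)
      rintro v (rfl | hv) w (rfl | hw) h
      · rfl
      · rw [hεr, hεL w hw] at h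
        exact absurd h (h1 w hw)
      · rw [hεr, hεL v hv] at h
        exact absurd h.symm (h1 v hv)
      · rw [hεL v hv, hεL w hw] at h
        rcases Sym2.eq_iff.1 h with ⟨h, -⟩ | ⟨h, -⟩
        · exact h
        · exact absurd (h ▸ hnb w hw) (hLD v hv)
    · intro v hv
      have hva : cls (ε v) = 0 ∨ a ∉ ε v := by
        rcases hv with rfl | hv
        · rw [hεr]
          rcases hab with ⟨rfl, -⟩ | ⟨hab, -⟩
          · left
            rw [← hsma]
            exact hclsS a ha
          · right
            intro h
            rcases Sym2.mem_iff.1 h with h | h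
            · exact hrD (h ▸ ha)
            · exact hab h
        · right
          rw [hεL v hv]
          intro h
          rcases Sym2.mem_iff.1 h with h | h
          · exact hLD v hv (h ▸ ha)
          · rcases hab with ⟨-, h'⟩ | ⟨-, h'⟩
            · exact h' v hv h.symm
            · simp [h'] at hv
      rcases hva with hva | hva
      · left; omega
      rcases hcls (ε v) with h | h | h
      · left; omega
      · refine Or.inr (Or.inl ⟨h, fun x hx hxv => ?_⟩)
        have hxa : x ≠ a := by
          rintro rfl
          exact hva (hxv ▸ hlg x)
        refine ⟨sm a, hsma ▸ mem_edgeFS.2 hra, hclsS a ha, hmin' _ (hclsS x hx) fun h => ?_⟩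
        have h1 := hsm x
        rw [h, hsma] at h1
        rcases Sym2.mem_iff.1 h1 with h1 | h1
        · exact hxr x hx h1
        · exact hxa h1
      · left; omega
    · intro x hx
      rw [hinc x _ _ (ho.adj x hx)]
      rcases smallEdge_or p q g x with ⟨h2, h3⟩ | ⟨h2, h3⟩ <;> ext e <;>
        simp only [sm, lg, h2, h3, mem_insert, mem_singleton]
      · exact Iff.rfl
      · exact or_comm
    · intro x hx y hy hxy
      rcases lt_or_gt_of_ne (fun h => hxy (hc.ν_inj hx hy h)) with h | h
      · exact Or.inl (hc.comp hx hy h)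
      · exact Or.inr (hc.comp hy hx h)
  exact hscheme.exists_labelling

/-- In a connected graph, a nonempty set of vertices closed under adjacency is everything. -/
theorem SimpleGraph.Connected.mem_of_closed {V : Type*} {G : SimpleGraph V}
    (hG : G.Connected) {S : Set V} {x : V} (hx : x ∈ S)
    (hS : ∀ u ∈ S, ∀ v, G.Adj u v → v ∈ S) (y : V) : y ∈ S := by
  obtain ⟨w⟩ := hG.preconnected x y
  induction w with
  | nil => exact hx
  | cons h _ ih => exact ih (hS _ hx _ h)

open Finset in
theorem card_edgeFS_le_two {V : Type*} [Fintype V] {G : SimpleGraph V} {e f : Sym2 V}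
    (h : ∀ v w, G.Adj v w → s(v, w) = e ∨ s(v, w) = f) : #(edgeFS G) ≤ 2 := by
  refine (card_le_card (t := {e, f}) fun x hx => ?_).trans card_le_two
  induction x with
  | _ v w => simpa using h v w (mem_edgeFS.1 hx)

/-- Every connected graph with `m ≥ 3` edges in which every vertex of
degree at least three is a support vertex is product antimagic: there is a bijection from
the edges to `{1, …, m}` with pairwise distinct induced vertex products. -/
theorem stmt_3 {V : Type*} [Fintype V] (G : SimpleGraph V) (m : ℕ) (hm : 3 ≤ m)
    (hcard : (edgeFS G).card = m) (hconn : G.Connected)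
    (hsupp : ∀ v : V, 3 ≤ G.degree v → ∃ u : V, G.Adj v u ∧ G.degree u = 1) :
    ∃ φ : Sym2 V → ℕ,
      Set.BijOn φ ↑(edgeFS G) ↑(Finset.Icc 1 m) ∧
      Function.Injective (fun v : V => ∏ e ∈ (edgeFS G).filter (fun e => v ∈ e), φ e) := by
  subst hcard
  have h1 : ∀ v, ∃ w, G.degree v = 1 → ∀ u, G.Adj v u ↔ u = w := by
    intro v
    by_cases h : G.degree v = 1
    · obtain ⟨w, hw⟩ := Finset.card_eq_one.1 h
      exact ⟨w, fun _ u => by rw [← G.mem_neighborFinset, hw, Finset.mem_singleton]⟩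
    · exact ⟨v, fun h' => absurd h' h⟩
  choose nb hnb using h1
  have h2 : ∀ v, G.degree v = 2 → ∃ y z, y ≠ z ∧ ∀ w, G.Adj v w ↔ w = y ∨ w = z := by
    intro v h
    obtain ⟨y, z, hyz, hw⟩ := Finset.card_eq_two.1 h
    exact ⟨y, z, hyz, fun w => by
      rw [← G.mem_neighborFinset, hw, Finset.mem_insert, Finset.mem_singleton]⟩
  have h0 : ∀ v, G.degree v ≠ 0 := by
    intro v h
    have hv : ∀ u, ¬ G.Adj v u := fun u hu => by
      have := (G.degree_pos_iff_exists_adj v).2 ⟨u, hu⟩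
      omega
    have hV := hconn.mem_of_closed (S := {v}) rfl
      (by rintro u rfl w hw; exact absurd hw (hv w))
    have := card_edgeFS_le_two (G := G) (e := s(v, v)) (f := s(v, v))
      (fun x y hxy => by
        obtain rfl : x = v := hV x
        exact absurd hxy (hv y))
    omega
  have hll : ∀ v, G.degree v = 1 → G.degree (nb v) ≠ 1 := by
    intro v hv hw
    have hvw : nb (nb v) = v := ((hnb _ hw v).1 ((hnb v hv _).2 rfl).symm).symm
    have hV := hconn.mem_of_closed (S := {v, nb v}) (Or.inl rfl) (by
      rintro u (rfl | rfl) w huw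
      · exact Or.inr ((hnb _ hv w).1 huw)
      · exact Or.inl (((hnb _ hw w).1 huw).trans hvw))
    have := card_edgeFS_le_two (G := G) (e := s(v, nb v)) (f := s(nb v, v))
      (fun x y hxy => by
        rcases hV x with rfl | rfl
        · rw [(hnb _ hv y).1 hxy]
          exact Or.inl rfl
        · rw [(hnb _ hw y).1 hxy, hvw]
          exact Or.inr rfl)
    omega
  by_cases hB : ∃ v, 3 ≤ G.degree v
  · have hlf : ∀ v, ∃ u, 3 ≤ G.degree v → G.Adj v u ∧ G.degree u = 1 := by
      intro v
      by_cases h : 3 ≤ G.degree v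
      · obtain ⟨u, hu⟩ := hsupp v h
        exact ⟨u, fun _ => hu⟩
      · exact ⟨v, fun h' => absurd h' h⟩
    choose lf hlf using hlf
    have hb : IsBranched G {v | G.degree v = 1} {v | G.degree v = 2} {v | 3 ≤ G.degree v}
        nb lf := by
      refine ⟨fun v => ?_, hnb, hll, h2, fun v hv u w => ?_, fun v hv => (hlf v hv).2,
        fun v hv => ?_⟩
      · have := h0 v
        simp only [Set.mem_ofPred_eq]
        omega
      · have hlt : ({u, w} : Finset V).card < (G.neighborFinset v).card :=
          lt_of_le_of_lt Finset.card_le_two hv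
        obtain ⟨z, hz, hz'⟩ := Finset.exists_mem_notMem_of_card_lt_card hlt
        simp only [Finset.mem_insert, Finset.mem_singleton, not_or] at hz'
        exact ⟨z, (G.mem_neighborFinset v z).1 hz, hz'⟩
      · exact ((hnb _ (hlf v hv).2 v).1 (hlf v hv).1.symm).symm
    exact hb.exists_labelling_of_connected hconn hB
  have h12 : ∀ v, G.degree v = 1 ∨ G.degree v = 2 := by
    intro v
    have := h0 v
    have : ¬ 3 ≤ G.degree v := fun h => hB ⟨v, h⟩
    omega
  by_cases hL : ∃ r, G.degree r = 1
  · obtain ⟨r, hr⟩ := hL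
    have hs : G.degree (nb r) = 2 := (h12 _).resolve_left (hll r hr)
    refine exists_labelling_of_path_or_cycle hconn (Lf := {v | G.degree v = 1 ∧ v ≠ r})
      (D := {v | G.degree v = 2}) (nb := nb) (r := r) (s := nb r) (t := nb r) (fun v => ?_)
      (fun h : G.degree r = 2 => by omega) (fun h => h.2 rfl) (fun v hv => hnb v hv.1)
      (fun v hv => (h12 _).resolve_left (hll v hv.1)) h2 hs hs
      (fun u => by rw [hnb r hr, or_self]) (Or.inl ⟨rfl, fun v hv hvr => ?_⟩)
    · have := h12 v
      simp only [Set.mem_ofPred_eq]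
      tauto
    · have hrs : G.Adj (nb r) r := ((hnb r hr _).2 rfl).symm
      have hvs : G.Adj (nb r) v := hvr ▸ ((hnb v hv.1 _).2 rfl).symm
      have hsn : ∀ u, G.Adj (nb r) u → u = r ∨ u = v := by
        obtain ⟨y, z, -, h⟩ := h2 _ hs
        intro u hu
        rw [h] at hu hrs hvs
        have := hv.2
        grind
      have hV := hconn.mem_of_closed (S := {r, nb r, v}) (Or.inl rfl) (by
        rintro u (rfl | rfl | rfl) w huw
        · exact Or.inr (Or.inl ((hnb _ hr w).1 huw))
        · rcases hsn w huw with h | h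
          · exact Or.inl h
          · exact Or.inr (Or.inr h)
        · exact Or.inr (Or.inl (((hnb _ hv.1 w).1 huw).trans hvr)))
      have := card_edgeFS_le_two (G := G) (e := s(r, nb r)) (f := s(v, nb r))
        (fun x y hxy => by
          rcases hV x with rfl | rfl | rfl
          · rw [(hnb _ hr y).1 hxy]
            exact Or.inl rfl
          · rcases hsn y hxy with rfl | rfl
            · exact Or.inl Sym2.eq_swap
            · exact Or.inr Sym2.eq_swap
          · rw [(hnb _ hv.1 y).1 hxy, hvr]
            exact Or.inr rfl)
      omega
  · have hd : ∀ v, G.degree v = 2 := fun v => (h12 v).resolve_left fun h => hL ⟨v, h⟩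
    obtain ⟨r⟩ := hconn.nonempty
    obtain ⟨s, t, hst, hadj⟩ := h2 r (hd r)
    exact exists_labelling_of_path_or_cycle hconn (Lf := ∅) (D := {v | v ≠ r}) (nb := nb)
      (fun v => (em (v = r)).imp_right Or.inl) (fun h => h rfl) (fun h => h) (fun _ h => h.elim)
      (fun _ h => h.elim) (fun x _ => h2 x (hd x)) ((hadj s).2 (Or.inl rfl)).ne'
      ((hadj t).2 (Or.inr rfl)).ne' hadj (Or.inr ⟨hst, rfl⟩)
end

section
/- Let m, n ≥ 3. If the complete bipartite graph K_{m,n} is a spanning subgraph of a graph G, then G is weighted universal antimagic. -/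
open scoped Classical

/-- Weighted universal antimagic. -/
def WeightedUnivAntimagic {V : Type*} [Fintype V] (G : SimpleGraph V) : Prop :=
  ∀ w : V → ℝ, (∀ v, 0 < w v) →
    ∀ L : Finset ℝ, (∀ x ∈ L, 0 < x) → L.card = (edgeFS G).card →
      ∃ φ : Sym2 V → ℝ, Set.BijOn φ ↑(edgeFS G) ↑L ∧
        Function.Injective (fun v => w v + vSum G φ v)

section Bipartite

open Finset

variable {α β : Type*} [Fintype α] [Fintype β]

/-- The weighted vertex sums of the labeling `f` of the edges of the complete bipartite graph
with parts `α` and `β`. -/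
noncomputable def bipartiteSum (w : α ⊕ β → ℝ) (f : α × β → ℝ) (v : α ⊕ β) : ℝ :=
  w v + Sum.elim (fun a => ∑ b, f (a, b)) (fun b => ∑ a, f (a, b)) v

/-- The labeling `f` maximizes the sum of squares of the vertex sums among its rearrangements. -/
def IsMaxRearrangement (w : α ⊕ β → ℝ) (f : α × β → ℝ) : Prop :=
  ∀ σ : Equiv.Perm (α × β),
    ∑ v, bipartiteSum w (f ∘ σ) v ^ 2 ≤ ∑ v, bipartiteSum w f v ^ 2

lemma bipartiteSum_swap (w : α ⊕ β → ℝ) (f : α × β → ℝ) (v : β ⊕ α) :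
    bipartiteSum (w ∘ Sum.swap) (f ∘ Prod.swap) v = bipartiteSum w f v.swap := by
  cases v <;> simp [bipartiteSum]

lemma IsMaxRearrangement.swap {w : α ⊕ β → ℝ} {f : α × β → ℝ} (h : IsMaxRearrangement w f) :
    IsMaxRearrangement (w ∘ Sum.swap) (f ∘ Prod.swap) := by
  intro σ
  have key := h (((Equiv.prodComm α β).trans σ).trans (Equiv.prodComm β α))
  have e : (f ∘ Prod.swap) ∘ σ =
      (f ∘ (((Equiv.prodComm α β).trans σ).trans (Equiv.prodComm β α))) ∘ Prod.swap := by
    ext ⟨b, a⟩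
    simp
  rw [e]
  simp only [bipartiteSum_swap]
  have h_sum (g : α ⊕ β → ℝ) : ∑ v : β ⊕ α, g v.swap = ∑ v, g v :=
    (Equiv.sumComm β α).sum_comp g
  rw [h_sum (fun v => bipartiteSum w _ v ^ 2), h_sum (fun v => bipartiteSum w _ v ^ 2)]
  exact key

lemma exists_isMaxRearrangement (w : α ⊕ β → ℝ) (f : α × β → ℝ) :
    ∃ σ : Equiv.Perm (α × β), IsMaxRearrangement w (f ∘ σ) := by
  obtain ⟨σ, hσ⟩ := Finite.exists_max
    (fun σ : Equiv.Perm (α × β) => ∑ v, bipartiteSum w (f ∘ σ) v ^ 2)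
  exact ⟨σ, fun τ => hσ (τ.trans σ)⟩

lemma bipartiteSum_comp_swap_inl (w : α ⊕ β → ℝ) (f : α × β → ℝ) (p q : α × β) (a : α) :
    bipartiteSum w (f ∘ Equiv.swap p q) (.inl a) = bipartiteSum w f (.inl a) +
      (f q - f p) * ((if a = p.1 then 1 else 0) - if a = q.1 then 1 else 0) := by
  have h (r : α × β) : (f ∘ Equiv.swap p q) r =
      f r + (f q - f p) * ((if r = p then 1 else 0) - if r = q then 1 else 0) := by
    by_cases hp : r = p
    · by_cases hq : r = q
      · subst hp; subst hq; simp
      · subst hp; simp [hq]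
    · by_cases hq : r = q
      · subst hq; simp [hp]
      · simp [Equiv.swap_apply_of_ne_of_ne hp hq, hp, hq]
  have h_ind (r : α × β) : ∑ b, (if (a, b) = r then (1 : ℝ) else 0) = if a = r.1 then 1 else 0 := by
    by_cases ha : a = r.1 <;> simp [Prod.ext_iff, ha]
  simp only [bipartiteSum, Sum.elim_inl, h, sum_add_distrib, ← mul_sum, sum_sub_distrib, h_ind]
  ring

lemma bipartiteSum_comp_swap_inr (w : α ⊕ β → ℝ) (f : α × β → ℝ) (p q : α × β) (b : β) :
    bipartiteSum w (f ∘ Equiv.swap p q) (.inr b) = bipartiteSum w f (.inr b) +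
      (f q - f p) * ((if b = p.2 then 1 else 0) - if b = q.2 then 1 else 0) := by
  have e : (f ∘ Equiv.swap p q) ∘ Prod.swap =
      (f ∘ Prod.swap) ∘ Equiv.swap p.swap q.swap := by
    ext r
    have := Prod.swap_injective.map_swap (x := p.swap) (y := q.swap) (z := r)
    simp_all
  have key := bipartiteSum_comp_swap_inl (w ∘ Sum.swap) (f ∘ Prod.swap) p.swap q.swap b
  rw [← e, bipartiteSum_swap, bipartiteSum_swap] at key
  simpa using key

lemma sum_sq_add_mul_indicator_sub {γ : Type*} [Fintype γ] (s : γ → ℝ) (x y : γ) (d : ℝ) :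
    ∑ i, (s i + d * ((if i = x then 1 else 0) - if i = y then 1 else 0)) ^ 2 =
      ∑ i, s i ^ 2 + 2 * d * (s x - s y) + d ^ 2 * (if x = y then 0 else 2) := by
  have h (i : γ) : (s i + d * ((if i = x then 1 else 0) - if i = y then 1 else 0)) ^ 2 =
      s i ^ 2 + (2 * d * ((if i = x then s i else 0) - if i = y then s i else 0) +
        d ^ 2 * ((if i = x then 1 else 0) + (if i = y then 1 else 0)
          - 2 * if i = x then (if x = y then 1 else 0) else 0)) := by
    by_cases h1 : i = x
    · subst h1
      split_ifs <;> ring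
    · simp only [h1, if_false]
      split_ifs <;> ring
  simp only [h, sum_add_distrib, ← mul_sum, sum_sub_distrib]
  simp only [sum_ite_eq', mem_univ, if_true]
  split_ifs <;> ring

lemma IsMaxRearrangement.mul_neg {w : α ⊕ β → ℝ} {f : α × β → ℝ} (h : IsMaxRearrangement w f)
    (hf : f.Injective) {p q : α × β} (hpq : p ≠ q) :
    (f q - f p) * (bipartiteSum w f (.inl p.1) + bipartiteSum w f (.inr p.2)
      - bipartiteSum w f (.inl q.1) - bipartiteSum w f (.inr q.2)) < 0 := by
  have hm := h (Equiv.swap p q)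
  have hd : 0 < (f q - f p) ^ 2 := by
    have : f q - f p ≠ 0 := sub_ne_zero.2 fun e => hpq (hf e.symm)
    positivity
  simp only [Fintype.sum_sum_type, bipartiteSum_comp_swap_inl, bipartiteSum_comp_swap_inr] at hm
  rw [sum_sq_add_mul_indicator_sub, sum_sq_add_mul_indicator_sub] at hm
  have h_pos : (0 : ℝ) < (if p.1 = q.1 then 0 else 2) + (if p.2 = q.2 then 0 else 2) := by
    split_ifs with h1 h2
    · exact absurd (Prod.ext h1 h2) hpq
    all_goals norm_num
  have := mul_pos hd h_pos
  linarith

lemma IsMaxRearrangement.eq_of_add_eq {w : α ⊕ β → ℝ} {f : α × β → ℝ}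
    (h : IsMaxRearrangement w f) (hf : f.Injective) {a a' : α} {b b' : β}
    (e : bipartiteSum w f (.inl a) + bipartiteSum w f (.inr b) =
      bipartiteSum w f (.inl a') + bipartiteSum w f (.inr b')) : a = a' ∧ b = b' := by
  by_contra hne
  have := h.mul_neg hf (p := (a, b)) (q := (a', b')) (by simpa using hne)
  simp only [e] at this
  simp at this

lemma IsMaxRearrangement.sq_sum_sub_le {w : α ⊕ β → ℝ} {f : α × β → ℝ}
    (h : IsMaxRearrangement w f) {b c : β} (hbc : b ≠ c) :
    (∑ a, (f (a, c) - f (a, b))) ^ 2 ≤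
      (∑ a, (f (a, c) - f (a, b))) * (bipartiteSum w f (.inr c) - bipartiteSum w f (.inr b)) := by
  have hm := h (Equiv.prodCongr (Equiv.refl α) (Equiv.swap b c))
  rw [Fintype.sum_sum_type, Fintype.sum_sum_type] at hm
  have hl (a : α) : bipartiteSum w
      (f ∘ Equiv.prodCongr (Equiv.refl α) (Equiv.swap b c)) (.inl a) =
      bipartiteSum w f (.inl a) := by
    simpa [bipartiteSum] using Equiv.sum_comp (Equiv.swap b c) (fun i => f (a, i))
  simp only [hl, add_le_add_iff_left] at hm
  rw [← sum_sdiff (subset_univ {b, c}), sum_pair hbc,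
    ← sum_sdiff (subset_univ {b, c}) (f := fun j => bipartiteSum w f (.inr j) ^ 2),
    sum_pair hbc] at hm
  have hr : ∑ j ∈ univ \ {b, c}, bipartiteSum w
      (f ∘ Equiv.prodCongr (Equiv.refl α) (Equiv.swap b c)) (.inr j) ^ 2 =
      ∑ j ∈ univ \ {b, c}, bipartiteSum w f (.inr j) ^ 2 := by
    refine sum_congr rfl fun j hj => ?_
    simp only [mem_sdiff, mem_univ, mem_insert, mem_singleton, true_and, not_or] at hj
    simp [bipartiteSum, Equiv.swap_apply_of_ne_of_ne hj.1 hj.2]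
  rw [hr, add_le_add_iff_left] at hm
  simp only [bipartiteSum, Sum.elim_inr, Function.comp_apply, Equiv.prodCongr_apply,
    Equiv.coe_refl, Prod.map_apply, id_eq, Equiv.swap_apply_left, Equiv.swap_apply_right,
    sum_sub_distrib] at hm ⊢
  linarith

lemma IsMaxRearrangement.exists_small_sub {w : α ⊕ β → ℝ} {f : α × β → ℝ}
    (h : IsMaxRearrangement w f) (hf : f.Injective) (hα : 3 ≤ Fintype.card α)
    {b c : β} (hbc : b ≠ c) :
    ∃ a : α, ∃ t : ℝ, 0 < t ∧ 2 * t < 1 ∧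
      f (a, c) - f (a, b) = t * (bipartiteSum w f (.inr c) - bipartiteSum w f (.inr b)) := by
  set D := bipartiteSum w f (.inr c) - bipartiteSum w f (.inr b) with hD
  have h_pos (a : α) : 0 < (f (a, c) - f (a, b)) * D := by
    have := h.mul_neg hf (p := (a, b)) (q := (a, c)) (by simpa using hbc)
    simp only [hD] at this ⊢
    linarith
  obtain ⟨a₀⟩ : Nonempty α := Fintype.card_pos_iff.1 (by omega)
  have hD0 : D ≠ 0 := by
    intro e
    simpa [e] using h_pos a₀
  have hD2 : 0 < D ^ 2 := by positivity
  obtain ⟨a, ha⟩ : ∃ a : α, 2 * ((f (a, c) - f (a, b)) * D) < D ^ 2 := by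
    by_contra! hc
    have h_sum := sum_le_sum fun a (_ : a ∈ univ) => hc a
    rw [← mul_sum, ← sum_mul] at h_sum
    simp only [sum_const, card_univ, nsmul_eq_mul] at h_sum
    have h_card : (3 : ℝ) ≤ Fintype.card α := by exact_mod_cast hα
    have h_sq := h.sq_sum_sub_le hbc
    rw [← hD] at h_sq
    set Δ := ∑ a, (f (a, c) - f (a, b))
    nlinarith [sq_nonneg (Δ - D)]
  refine ⟨a, (f (a, c) - f (a, b)) / D, ?_, ?_, by field_simp⟩
  · have := div_pos (h_pos a) hD2
    rwa [pow_two, mul_div_mul_right _ _ hD0] at this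
  · have := (div_lt_one hD2).2 ha
    rwa [pow_two, mul_div_assoc, mul_div_mul_right _ _ hD0] at this

/-- If `a` and `b` carry the only collision of `s`, and `s c` is a value nearest to the common
value of `a` and `b`, then moving `b` and `c` slightly towards each other separates all values. -/
lemma injective_of_move_towards {ι : Type*} {s s' : ι → ℝ} {a b c : ι} (hab : a ≠ b)
    (hs : s a = s b) (hcb : s c ≠ s b)
    (hcoll : ∀ v, v ≠ b → ∀ v', v' ≠ b → s v = s v' → v = v')
    (hnear : ∀ v, s v ≠ s b → (s c - s b) ^ 2 ≤ (s v - s b) ^ 2) {t : ℝ} (ht0 : 0 < t)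
    (ht1 : 2 * t < 1) (hb : s' b = s b + t * (s c - s b)) (hc : s' c = s c - t * (s c - s b))
    (h_other : ∀ v, v ≠ b → v ≠ c → s' v = s v) : s'.Injective := by
  set D := s c - s b with hD
  have hD0 : D ≠ 0 := sub_ne_zero.2 hcb
  have hD2 : 0 < D ^ 2 := by positivity
  have h_gap (v : ι) (r : ℝ) (hr0 : 0 < r) (hr1 : r < 1) : s v ≠ s b + r * D := by
    intro e
    have hv : s v - s b = r * D := by linarith
    have := hnear v (fun e' => by
      rw [e', sub_self] at hv
      exact mul_ne_zero hr0.ne' hD0 hv.symm)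
    rw [hv, mul_pow] at this
    nlinarith [mul_pos hr0 hD2, mul_pos (mul_pos hr0 hD2) (sub_pos.2 hr1)]
  have hc' : s' c = s b + (1 - t) * D := by rw [hc, hD]; ring
  have hbc : s' b ≠ s' c := by
    rw [hb, hc']
    intro e
    have : (1 - 2 * t) * D = 0 := by linarith
    exact mul_ne_zero (by linarith) hD0 this
  intro v v' e
  by_cases h1 : v = b <;> by_cases h2 : v' = b
  · rw [h1, h2]
  · subst h1
    by_cases h3 : v' = c
    · subst h3; exact absurd e hbc
    · rw [h_other _ h2 h3, hb] at e
      exact absurd e.symm (h_gap _ _ ht0 (by linarith))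
  · subst h2
    by_cases h3 : v = c
    · subst h3; exact absurd e.symm hbc
    · rw [h_other _ h1 h3, hb] at e
      exact absurd e (h_gap _ _ ht0 (by linarith))
  · by_cases h3 : v = c <;> by_cases h4 : v' = c
    · rw [h3, h4]
    · subst h3
      rw [h_other _ h2 h4, hc'] at e
      exact absurd e.symm (h_gap _ _ (by linarith) (by linarith))
    · subst h4
      rw [h_other _ h1 h3, hc'] at e
      exact absurd e (h_gap _ _ (by linarith) (by linarith))
    · rw [h_other _ h1 h3, h_other _ h2 h4] at e
      exact hcoll v h1 v' h2 e

lemma IsMaxRearrangement.inl_injective [Nonempty β] {w : α ⊕ β → ℝ} {f : α × β → ℝ}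
    (h : IsMaxRearrangement w f) (hf : f.Injective) {a a' : α}
    (e : bipartiteSum w f (.inl a) = bipartiteSum w f (.inl a')) : a = a' :=
  (h.eq_of_add_eq hf (b := Classical.arbitrary β) (b' := Classical.arbitrary β) (by rw [e])).1

lemma IsMaxRearrangement.inr_injective [Nonempty α] {w : α ⊕ β → ℝ} {f : α × β → ℝ}
    (h : IsMaxRearrangement w f) (hf : f.Injective) {b b' : β}
    (e : bipartiteSum w f (.inr b) = bipartiteSum w f (.inr b')) : b = b' :=
  (h.eq_of_add_eq hf (a := Classical.arbitrary α) (a' := Classical.arbitrary α) (by rw [e])).2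

lemma IsMaxRearrangement.exists_injective_of_nearest {w : α ⊕ β → ℝ} {f : α × β → ℝ}
    (h : IsMaxRearrangement w f) (hf : f.Injective) (hα : 3 ≤ Fintype.card α)
    {a : α} {b c : β} (hab : bipartiteSum w f (.inl a) = bipartiteSum w f (.inr b))
    (hcb : bipartiteSum w f (.inr c) ≠ bipartiteSum w f (.inr b))
    (hnear : ∀ v, bipartiteSum w f v ≠ bipartiteSum w f (.inr b) →
      (bipartiteSum w f (.inr c) - bipartiteSum w f (.inr b)) ^ 2 ≤
        (bipartiteSum w f v - bipartiteSum w f (.inr b)) ^ 2) :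
    ∃ σ : Equiv.Perm (α × β), (bipartiteSum w (f ∘ σ)).Injective := by
  have : Nonempty α := ⟨a⟩
  have : Nonempty β := ⟨b⟩
  have hbc : b ≠ c := by rintro rfl; exact hcb rfl
  obtain ⟨u, t, ht0, ht1, hu⟩ := h.exists_small_sub hf hα hbc
  refine ⟨Equiv.swap (u, b) (u, c), injective_of_move_towards (a := .inl a) (b := .inr b)
    (c := .inr c) (by simp) hab hcb ?_ hnear ht0 ht1 ?_ ?_ ?_⟩
  · have h_cross (a' : α) (b' : β) (hb' : b' ≠ b) :
        bipartiteSum w f (.inl a') ≠ bipartiteSum w f (.inr b') := fun e =>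
      hb' (h.eq_of_add_eq hf (a := a) (a' := a') (by rw [hab, e, add_comm])).2
    rintro (a₁ | b₁) h₁ (a₂ | b₂) h₂ e
    · rw [h.inl_injective hf e]
    · exact absurd e (h_cross a₁ b₂ (by simpa using h₂))
    · exact absurd e.symm (h_cross a₂ b₁ (by simpa using h₁))
    · rw [h.inr_injective hf e]
  · rw [bipartiteSum_comp_swap_inr, hu]
    simp [hbc]
  · rw [bipartiteSum_comp_swap_inr, hu]
    simp [hbc.symm, sub_eq_add_neg]
  · rintro (a' | b') h₁ h₂
    · rw [bipartiteSum_comp_swap_inl]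
      simp
    · rw [bipartiteSum_comp_swap_inr]
      simp only [ne_eq, Sum.inr.injEq] at h₁ h₂
      simp [h₁, h₂]

lemma exists_perm_bipartiteSum_injective (hα : 3 ≤ Fintype.card α) (hβ : 3 ≤ Fintype.card β)
    (w : α ⊕ β → ℝ) {f : α × β → ℝ} (hf : f.Injective) :
    ∃ σ : Equiv.Perm (α × β), (bipartiteSum w (f ∘ σ)).Injective := by
  have : Nonempty α := Fintype.card_pos_iff.1 (by omega)
  have : Nonempty β := Fintype.card_pos_iff.1 (by omega)
  obtain ⟨τ, h⟩ := exists_isMaxRearrangement w f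
  have hg : (f ∘ τ).Injective := hf.comp τ.injective
  suffices ∃ σ : Equiv.Perm (α × β), (bipartiteSum w ((f ∘ τ) ∘ σ)).Injective from
    this.elim fun σ hσ => ⟨σ.trans τ, hσ⟩
  generalize f ∘ τ = g at h hg
  by_cases h_coll : ∃ a b, bipartiteSum w g (.inl a) = bipartiteSum w g (.inr b)
  · obtain ⟨a, b, hab⟩ := h_coll
    obtain ⟨b', hb'⟩ : ∃ b' : β, b' ≠ b :=
      have : Nontrivial β := Fintype.one_lt_card_iff_nontrivial.1 (by omega)
      exists_ne b
    obtain ⟨c, hc, hnear⟩ := exists_min_image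
      (univ.filter fun v => bipartiteSum w g v ≠ bipartiteSum w g (.inr b))
      (fun v => (bipartiteSum w g v - bipartiteSum w g (.inr b)) ^ 2)
      ⟨.inr b', by simpa using fun e => hb' (h.inr_injective hg e)⟩
    simp only [mem_filter, mem_univ, true_and] at hc hnear
    cases c with
    | inr c => exact h.exists_injective_of_nearest hg hα hab hc hnear
    | inl c =>
      obtain ⟨σ, hσ⟩ := h.swap.exists_injective_of_nearest (hg.comp Prod.swap_injective) hβ
        (a := b) (b := a) (c := c) (by simpa [bipartiteSum_swap] using hab.symm)
        (by simpa [bipartiteSum_swap, hab] using hc)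
        (by
          intro v hv
          simp only [bipartiteSum_swap, Sum.swap_inr, hab] at hv ⊢
          exact hnear _ hv)
      refine ⟨((Equiv.prodComm α β).trans σ).trans (Equiv.prodComm β α), ?_⟩
      have e : (g ∘ Prod.swap) ∘ σ =
          (g ∘ (((Equiv.prodComm α β).trans σ).trans (Equiv.prodComm β α))) ∘ Prod.swap := by
        ext ⟨b, a⟩
        simp
      rw [e] at hσ
      intro v v' hv
      have := @hσ v.swap v'.swap (by simpa only [bipartiteSum_swap, Sum.swap_swap] using hv)
      simpa using congrArg Sum.swap this
  · push Not at h_coll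
    refine ⟨1, ?_⟩
    rintro (a₁ | b₁) (a₂ | b₂) e
    · rw [h.inl_injective hg e]
    · exact absurd e (h_coll a₁ b₂)
    · exact absurd e.symm (h_coll a₂ b₁)
    · rw [h.inr_injective hg e]

end Bipartite

/-- The edge between two vertices from different parts, seen in a graph on `V`. -/
def crossEdge {V α β : Type*} (e : V ≃ α ⊕ β) (p : α × β) : Sym2 V :=
  s(e.symm (.inl p.1), e.symm (.inr p.2))

lemma crossEdge_injective {V α β : Type*} (e : V ≃ α ⊕ β) : (crossEdge e).Injective := by
  rintro ⟨a, b⟩ ⟨a', b'⟩ h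
  simpa [crossEdge] using h

lemma mem_crossEdge_inl {V α β : Type*} (e : V ≃ α ⊕ β) (p : α × β) (a : α) :
    e.symm (.inl a) ∈ crossEdge e p ↔ p.1 = a := by
  simp [crossEdge, eq_comm]

lemma mem_crossEdge_inr {V α β : Type*} (e : V ≃ α ⊕ β) (p : α × β) (b : β) :
    e.symm (.inr b) ∈ crossEdge e p ↔ p.2 = b := by
  simp [crossEdge, eq_comm]

lemma vSum_eq_add_sum_crossEdge {V α β : Type*} [Fintype V] [Fintype α] [Fintype β]
    (G : SimpleGraph V) (e : V ≃ α ⊕ β) (hG : ∀ p, crossEdge e p ∈ edgeFS G)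
    (φ : Sym2 V → ℝ) (x : α ⊕ β) :
    vSum G φ (e.symm x) =
      ∑ d ∈ edgeFS G with d ∉ Set.range (crossEdge e), (if e.symm x ∈ d then φ d else 0) +
      Sum.elim (fun a => ∑ b, φ (crossEdge e (a, b))) (fun b => ∑ a, φ (crossEdge e (a, b))) x := by
  have h_range : (edgeFS G).filter (fun d => d ∈ Set.range (crossEdge e)) =
      Finset.univ.image (crossEdge e) := by
    ext d
    simp only [Finset.mem_filter, Set.mem_range, Finset.mem_image, Finset.mem_univ, true_and,
      and_iff_right_iff_imp]
    rintro ⟨p, rfl⟩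
    exact hG p
  rw [vSum, Finset.sum_filter,
    ← Finset.sum_filter_add_sum_filter_not _ (fun d => d ∈ Set.range (crossEdge e)), add_comm,
    h_range, Finset.sum_image (crossEdge_injective e).injOn]
  congr 1
  cases x with
  | inl a => simp [mem_crossEdge_inl, Fintype.sum_prod_type_right]
  | inr b => simp [mem_crossEdge_inr, Fintype.sum_prod_type]

/-- Let `m, n ≥ 3`. If `K_{m,n}` is a spanning subgraph of `G`, then `G`
is weighted universal antimagic. -/
theorem stmt_9 {V : Type*} [Fintype V] (m n : ℕ) (hm : 3 ≤ m) (hn : 3 ≤ n)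
    (G : SimpleGraph V) (e : V ≃ (Fin m ⊕ Fin n))
    (hsub : ∀ a b : V, (completeBipartiteGraph (Fin m) (Fin n)).Adj (e a) (e b) → G.Adj a b) :
    WeightedUnivAntimagic G := by
  intro w _ L _ hL
  have hG (p : Fin m × Fin n) : crossEdge e p ∈ edgeFS G := by
    simpa [edgeFS, crossEdge] using hsub _ _ (by simp)
  obtain ⟨φ, hφ⟩ := (edgeFS G).finite_toSet.exists_bijOn_of_encard_eq
    (t := (L : Set ℝ)) (by simp [hL])
  let ι : Fin m × Fin n ↪ Sym2 V := ⟨crossEdge e, crossEdge_injective e⟩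
  have h_inj : (φ ∘ ι).Injective := fun p q h => ι.injective (hφ.injOn (hG p) (hG q) h)
  let w' (x : Fin m ⊕ Fin n) : ℝ := w (e.symm x) +
    ∑ d ∈ edgeFS G with d ∉ Set.range (crossEdge e), (if e.symm x ∈ d then φ d else 0)
  obtain ⟨σ, hσ⟩ := exists_perm_bipartiteSum_injective (by simpa) (by simpa) w' h_inj
  let τ : Equiv.Perm (Sym2 V) := σ.viaEmbedding ι
  have hτ (p : Fin m × Fin n) : τ (crossEdge e p) = crossEdge e (σ p) :=
    σ.viaEmbedding_apply ι p
  have hτ' (d : Sym2 V) (hd : d ∉ Set.range (crossEdge e)) : τ d = d :=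
    σ.viaEmbedding_apply_of_notMem ι d hd
  refine ⟨φ ∘ τ, hφ.comp ?_, ?_⟩
  · have h_maps : Set.MapsTo τ (edgeFS G) (edgeFS G) := by
      intro d hd
      by_cases hr : d ∈ Set.range (crossEdge e)
      · obtain ⟨p, rfl⟩ := hr
        rw [hτ]
        exact hG _
      · rwa [hτ' d hr]
    exact ⟨h_maps, τ.injective.injOn,
      Finset.surjOn_of_injOn_of_card_le τ h_maps τ.injective.injOn le_rfl⟩
  · have key (x : Fin m ⊕ Fin n) :
        w (e.symm x) + vSum G (φ ∘ τ) (e.symm x) = bipartiteSum w' ((φ ∘ ι) ∘ σ) x := by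
      rw [vSum_eq_add_sum_crossEdge G e hG, bipartiteSum, ← add_assoc]
      congr 1
      · refine congrArg _ (Finset.sum_congr rfl fun d hd => ?_)
        rw [Function.comp_apply, hτ' d (Finset.mem_filter.1 hd).2]
      · simp only [Function.comp_apply, hτ]
        rfl
    intro v v' h
    apply e.injective
    apply hσ
    rw [← key, ← key]
    simpa using h
end

section
/- Let m, n ≥ 3. If the complete bipartite graph K_{m,n} is a spanning subgraph of a graph G, then every leafy graph of G is universal antimagic. -/
open scoped Classical

/-- `G` has an antimagic `L`-labeling for every set `L` of `(edgeFS G).card` positive reals. -/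
def UnivAntimagic {V : Type*} [Fintype V] (G : SimpleGraph V) : Prop :=
  ∀ L : Finset ℝ, (∀ x ∈ L, 0 < x) → L.card = (edgeFS G).card →
    ∃ φ : Sym2 V → ℝ, Set.BijOn φ ↑(edgeFS G) ↑L ∧ Function.Injective (vSum G φ)

/-- `G'` is a leafy graph of `G`: `G'` is obtained from `G` by attaching a non-negative
number of new pendant edges (new leaves) to each interior vertex (degree at least two)
of `G`. -/
def IsLeafyGraphOf {V V' : Type*} [Fintype V] [Fintype V'] (G' : SimpleGraph V')
    (G : SimpleGraph V) : Prop :=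
  ∃ f : V ↪ V',
    (∀ u v : V, G'.Adj (f u) (f v) ↔ G.Adj u v) ∧
    (∀ x : V', x ∉ Set.range f →
      G'.degree x = 1 ∧ ∃ v : V, G'.Adj x (f v) ∧ 2 ≤ G.degree v)

open Finset

lemma comp_swap_apply {ι : Type*} [DecidableEq ι] (x : ι → ℝ) (p q z : ι) :
    (x ∘ Equiv.swap p q) z =
      x z + (x q - x p) * ((if z = p then 1 else 0) - (if z = q then 1 else 0)) := by
  by_cases hp : z = p
  · subst hp
    by_cases hq : z = q
    · subst hq; simp
    · simp [hq]
  · by_cases hq : z = q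
    · subst hq; simp [hp]
    · simp [hp, hq, Equiv.swap_apply_of_ne_of_ne hp hq]

lemma sum_sq_add_indicator_sub {ι : Type*} [Fintype ι] (s : ι → ℝ) (d : ℝ) (i j : ι) :
    ∑ k, (s k + d * ((if k = i then 1 else 0) - (if k = j then 1 else 0))) ^ 2 =
      ∑ k, s k ^ 2 + 2 * d * (s i - s j) + if i = j then 0 else 2 * d ^ 2 := by
  rcases eq_or_ne i j with rfl | hij
  · simp
  have h : ∀ k, (s k + d * ((if k = i then 1 else 0) - (if k = j then 1 else 0))) ^ 2 =
      s k ^ 2 + ((if k = i then 2 * d * s k + d ^ 2 else 0) +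
        (if k = j then -2 * d * s k + d ^ 2 else 0)) := by
    intro k
    by_cases hi : k = i
    · subst hi; simp [hij]; ring
    · by_cases hj : k = j
      · subst hj; simp [hij.symm]; ring
      · simp [hi, hj]
  simp only [h, sum_add_distrib, sum_ite_eq', mem_univ, if_true, if_neg hij]
  ring

/-- Conjugation of rearrangements by the exchange of the two parts. -/
lemma comp_swap_comp_perm {A B : Type*} (x : A × B → ℝ) (σ : Equiv.Perm (B × A)) :
    (x ∘ Prod.swap) ∘ σ = (x ∘ (Equiv.prodComm A B).trans (σ.trans (Equiv.prodComm B A))) ∘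
      Prod.swap := by
  ext p; simp

section WeightedCompleteBipartite

variable {A B : Type*} [Fintype A] [Fintype B]

/-- Vertex sums of the edge labeling `x` of the complete bipartite graph with parts `A` and `B`
and vertex weights `w`. -/
def biSum (w : A ⊕ B → ℝ) (x : A × B → ℝ) : A ⊕ B → ℝ :=
  Sum.elim (fun a => w (.inl a) + ∑ b, x (a, b)) (fun b => w (.inr b) + ∑ a, x (a, b))

@[simp] lemma biSum_inl (w : A ⊕ B → ℝ) (x : A × B → ℝ) (a : A) :
    biSum w x (.inl a) = w (.inl a) + ∑ b, x (a, b) := rfl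

@[simp] lemma biSum_inr (w : A ⊕ B → ℝ) (x : A × B → ℝ) (b : B) :
    biSum w x (.inr b) = w (.inr b) + ∑ a, x (a, b) := rfl

/-- The labeling `x` maximizes the sum of the squares of the vertex sums among all its
rearrangements. -/
def IsMaxLabeling (w : A ⊕ B → ℝ) (x : A × B → ℝ) : Prop :=
  ∀ σ : Equiv.Perm (A × B), ∑ v, biSum w (x ∘ σ) v ^ 2 ≤ ∑ v, biSum w x v ^ 2

lemma exists_isMaxLabeling (w : A ⊕ B → ℝ) (x : A × B → ℝ) :
    ∃ σ : Equiv.Perm (A × B), IsMaxLabeling w (x ∘ σ) := by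
  obtain ⟨σ, hσ⟩ := Finite.exists_max
    fun σ : Equiv.Perm (A × B) => ∑ v, biSum w (x ∘ σ) v ^ 2
  exact ⟨σ, fun τ => hσ (σ * τ)⟩

lemma biSum_comp_swap_inl (w : A ⊕ B → ℝ) (x : A × B → ℝ) (p q : A × B) (a : A) :
    biSum w (x ∘ Equiv.swap p q) (.inl a) = biSum w x (.inl a) +
      (x q - x p) * ((if a = p.1 then 1 else 0) - (if a = q.1 then 1 else 0)) := by
  obtain ⟨p₁, p₂⟩ := p
  obtain ⟨q₁, q₂⟩ := q
  simp only [biSum_inl, comp_swap_apply, sum_add_distrib, ← mul_sum, sum_sub_distrib,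
    Prod.mk.injEq, ite_and, add_assoc]
  congr 4 <;> split_ifs <;> simp

lemma biSum_comp_swap_inr (w : A ⊕ B → ℝ) (x : A × B → ℝ) (p q : A × B) (b : B) :
    biSum w (x ∘ Equiv.swap p q) (.inr b) = biSum w x (.inr b) +
      (x q - x p) * ((if b = p.2 then 1 else 0) - (if b = q.2 then 1 else 0)) := by
  obtain ⟨p₁, p₂⟩ := p
  obtain ⟨q₁, q₂⟩ := q
  simp only [biSum_inr, comp_swap_apply, sum_add_distrib, ← mul_sum, sum_sub_distrib,
    Prod.mk.injEq, and_comm (b := b = _), ite_and, add_assoc]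
  congr 4 <;> split_ifs <;> simp

/-- In a maximal labeling, the labels are ordered as the sums of the end vertices. -/
lemma IsMaxLabeling.sum_ends_lt {w : A ⊕ B → ℝ} {x : A × B → ℝ} (hx : IsMaxLabeling w x)
    {p q : A × B} (h : x p < x q) :
    biSum w x (.inl p.1) + biSum w x (.inr p.2) <
      biSum w x (.inl q.1) + biSum w x (.inr q.2) := by
  have hne : p.1 ≠ q.1 ∨ p.2 ≠ q.2 := by
    by_contra! hc
    exact h.ne (congrArg x (Prod.ext hc.1 hc.2))
  have hm := hx (Equiv.swap p q)
  simp only [Fintype.sum_sum_type, biSum_comp_swap_inl, biSum_comp_swap_inr,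
    sum_sq_add_indicator_sub _ _ p.1 q.1, sum_sq_add_indicator_sub _ _ p.2 q.2] at hm
  have hd : 0 < x q - x p := sub_pos.2 h
  have h1 : 0 < (if p.1 = q.1 then 0 else 2 * (x q - x p) ^ 2) +
      (if p.2 = q.2 then 0 else 2 * (x q - x p) ^ 2) := by
    have := pow_pos hd 2
    split_ifs <;> first | positivity | simp_all
  by_contra! hc
  nlinarith [mul_nonneg hd.le (sub_nonneg.2 hc)]

lemma IsMaxLabeling.sum_ends_injective {w : A ⊕ B → ℝ} {x : A × B → ℝ}
    (hx : IsMaxLabeling w x) (hinj : Function.Injective x) :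
    Function.Injective fun p : A × B => biSum w x (.inl p.1) + biSum w x (.inr p.2) := by
  intro p q h
  apply hinj
  rcases lt_trichotomy (x p) (x q) with h' | h' | h'
  · exact absurd h (hx.sum_ends_lt h').ne
  · exact h'
  · exact absurd h (hx.sum_ends_lt h').ne'

lemma IsMaxLabeling.lt_of_biSum_inr_lt {w : A ⊕ B → ℝ} {x : A × B → ℝ}
    (hx : IsMaxLabeling w x) (hinj : Function.Injective x) {b b' : B}
    (h : biSum w x (.inr b) < biSum w x (.inr b')) (a : A) : x (a, b) < x (a, b') := by
  rcases lt_trichotomy (x (a, b)) (x (a, b')) with h' | h' | h'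
  · exact h'
  · cases hinj h'
    exact absurd h (lt_irrefl _)
  · have := hx.sum_ends_lt h'
    simp only at this
    linarith

/-- Exchanging two columns of a maximal labeling does not increase the potential. -/
lemma IsMaxLabeling.sum_sub_le {w : A ⊕ B → ℝ} {x : A × B → ℝ} (hx : IsMaxLabeling w x)
    {b b' : B} (hpos : 0 < ∑ a, (x (a, b') - x (a, b))) :
    ∑ a, (x (a, b') - x (a, b)) ≤ biSum w x (.inr b') - biSum w x (.inr b) := by
  have hne : b ≠ b' := by
    rintro rfl
    simp at hpos
  set D := ∑ a, (x (a, b') - x (a, b)) with hD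
  have hm := hx (Equiv.prodCongr (Equiv.refl A) (Equiv.swap b b'))
  have hl : ∀ a, biSum w (x ∘ Equiv.prodCongr (Equiv.refl A) (Equiv.swap b b')) (.inl a) =
      biSum w x (.inl a) := fun a => by
    simp only [biSum_inl, Function.comp, Equiv.prodCongr_apply, Prod.map_apply, Equiv.refl_apply]
    rw [Equiv.sum_comp (Equiv.swap b b') fun b => x (a, b)]
  have hr : ∀ c, biSum w (x ∘ Equiv.prodCongr (Equiv.refl A) (Equiv.swap b b')) (.inr c) =
      biSum w x (.inr c) + D * ((if c = b then 1 else 0) - (if c = b' then 1 else 0)) := by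
    intro c
    simp only [biSum_inr, Function.comp, Equiv.prodCongr_apply, Prod.map_apply, Equiv.refl_apply,
      hD, sum_sub_distrib]
    by_cases hb : c = b
    · subst hb; simp [hne]
    · by_cases hb' : c = b'
      · subst hb'; simp [hb]
      · simp [hb, hb', Equiv.swap_apply_of_ne_of_ne hb hb']
  simp only [Fintype.sum_sum_type, hl, hr, sum_sq_add_indicator_sub, if_neg hne] at hm
  by_contra! hc
  nlinarith [mul_pos hpos (sub_pos.2 hc)]

/-- If the sums at `b` and `b'` are consecutive values of a maximal labeling, then exchanging the
labels of two edges moves both of them strictly inside the interval that they span. -/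
lemma IsMaxLabeling.exists_injective_of_consecutive {w : A ⊕ B → ℝ} {x : A × B → ℝ}
    (hx : IsMaxLabeling w x) (hinj : Function.Injective x) (hA : 3 ≤ Fintype.card A) {b b' : B}
    (hlt : biSum w x (.inr b) < biSum w x (.inr b'))
    (hgap : ∀ v, v ≠ .inr b → v ≠ .inr b' →
      biSum w x v ∉ Set.Ioo (biSum w x (.inr b)) (biSum w x (.inr b')))
    (hon : Set.InjOn (biSum w x) {v | v ≠ .inr b ∧ v ≠ .inr b'}) :
    ∃ σ : Equiv.Perm (A × B), Function.Injective (biSum w (x ∘ σ)) := by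
  have : Nonempty A := Fintype.card_pos_iff.1 (by omega)
  have hne : b ≠ b' := by rintro rfl; exact lt_irrefl _ hlt
  have hd := hx.lt_of_biSum_inr_lt hinj hlt
  obtain ⟨a, ha⟩ := Finite.exists_min fun a => x (a, b') - x (a, b)
  have hpos : 0 < ∑ a, (x (a, b') - x (a, b)) :=
    sum_pos (fun a _ => sub_pos.2 (hd a)) univ_nonempty
  have h3 : 3 * (x (a, b') - x (a, b)) ≤ biSum w x (.inr b') - biSum w x (.inr b) :=
    calc 3 * (x (a, b') - x (a, b)) ≤ Fintype.card A * (x (a, b') - x (a, b)) := by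
          have : (3 : ℝ) ≤ Fintype.card A := by exact_mod_cast hA
          exact mul_le_mul_of_nonneg_right this (sub_pos.2 (hd a)).le
      _ ≤ ∑ a, (x (a, b') - x (a, b)) := by
          simpa using card_nsmul_le_sum univ _ _ fun c _ => ha c
      _ ≤ _ := hx.sum_sub_le hpos
  have hδ := sub_pos.2 (hd a)
  set δ := x (a, b') - x (a, b) with hδdef
  set s := biSum w x with hs
  refine ⟨Equiv.swap (a, b) (a, b'), ?_⟩
  have hb : biSum w (x ∘ Equiv.swap (a, b) (a, b')) (.inr b) = s (.inr b) + δ := by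
    rw [biSum_comp_swap_inr]; simp [hne, hδdef, hs]
  have hb' : biSum w (x ∘ Equiv.swap (a, b) (a, b')) (.inr b') = s (.inr b') - δ := by
    rw [biSum_comp_swap_inr]; simp [hne.symm, hδdef, hs]; ring
  have ho : ∀ v, v ≠ .inr b → v ≠ .inr b' →
      biSum w (x ∘ Equiv.swap (a, b) (a, b')) v = s v := by
    rintro (c | c) h h'
    · rw [biSum_comp_swap_inl]; simp [hs]
    · rw [biSum_comp_swap_inr]
      simp only [ne_eq, Sum.inr.injEq] at h h'
      simp [h, h', hs]
  have key : ∀ v, v ≠ .inr b → v ≠ .inr b' →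
      s v ≠ s (.inr b) + δ ∧ s v ≠ s (.inr b') - δ := by
    intro v h h'
    constructor <;> intro hv <;> exact hgap v h h' ⟨by linarith, by linarith⟩
  intro u v huv
  by_cases hu : u = .inr b
  · by_cases hv : v = .inr b
    · rw [hu, hv]
    · by_cases hv' : v = .inr b'
      · rw [hu, hv', hb, hb'] at huv
        linarith
      · rw [hu, hb, ho v hv hv'] at huv
        exact absurd huv.symm (key v hv hv').1
  · by_cases hu' : u = .inr b'
    · by_cases hv : v = .inr b
      · rw [hu', hv, hb, hb'] at huv
        linarith
      · by_cases hv' : v = .inr b'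
        · rw [hu', hv']
        · rw [hu', hb', ho v hv hv'] at huv
          exact absurd huv.symm (key v hv hv').2
    · rw [ho u hu hu'] at huv
      by_cases hv : v = .inr b
      · rw [hv, hb] at huv
        exact absurd huv (key u hu hu').1
      · by_cases hv' : v = .inr b'
        · rw [hv', hb'] at huv
          exact absurd huv (key u hu hu').2
        · rw [ho v hv hv'] at huv
          exact hon ⟨hu, hu'⟩ ⟨hv, hv'⟩ huv

/-- A coincidence with the sum at `j` can be removed if the closest remaining value is attained at
a vertex `l` on the same side as `j`. -/
lemma IsMaxLabeling.exists_injective_of_nearest {w : A ⊕ B → ℝ} {x : A × B → ℝ}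
    (hx : IsMaxLabeling w x) (hinj : Function.Injective x) (hA : 3 ≤ Fintype.card A)
    {i : A} {j l : B} (hij : biSum w x (.inl i) = biSum w x (.inr j)) (hjl : l ≠ j)
    (hon : Set.InjOn (biSum w x) {v | v ≠ .inr j})
    (hmin : ∀ v, v ≠ .inl i → v ≠ .inr j →
      |biSum w x (.inr l) - biSum w x (.inr j)| ≤ |biSum w x v - biSum w x (.inr j)|) :
    ∃ σ : Equiv.Perm (A × B), Function.Injective (biSum w (x ∘ σ)) := by
  have hne : biSum w x (.inr l) ≠ biSum w x (.inr j) := by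
    rw [← hij]
    intro h
    have := hon (by simpa using hjl) (by simp) h
    cases this
  rcases lt_or_gt_of_ne hne with h | h
  · refine hx.exists_injective_of_consecutive hinj hA h ?_ (hon.mono fun v hv => hv.2)
    intro v _ hv ⟨h1, h2⟩
    by_cases hvi : v = .inl i
    · rw [hvi, hij] at h2
      exact lt_irrefl _ h2
    · have := hmin v hvi hv
      rw [abs_of_neg (by linarith), abs_of_neg (by linarith)] at this
      linarith
  · refine hx.exists_injective_of_consecutive hinj hA h ?_ (hon.mono fun v hv => hv.1)
    intro v hv _ ⟨h1, h2⟩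
    by_cases hvi : v = .inl i
    · rw [hvi, hij] at h1
      exact lt_irrefl _ h1
    · have := hmin v hvi hv
      rw [abs_of_pos (by linarith), abs_of_pos (by linarith)] at this
      linarith

lemma biSum_swap (w : A ⊕ B → ℝ) (x : A × B → ℝ) :
    biSum (w ∘ Sum.swap) (x ∘ Prod.swap) = biSum w x ∘ Sum.swap := by
  ext (b | a) <;> simp

lemma IsMaxLabeling.swap {w : A ⊕ B → ℝ} {x : A × B → ℝ} (hx : IsMaxLabeling w x) :
    IsMaxLabeling (w ∘ Sum.swap) (x ∘ Prod.swap) := by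
  intro σ
  have hsum : ∀ y : A × B → ℝ,
      ∑ v, biSum (w ∘ Sum.swap) (y ∘ Prod.swap) v ^ 2 = ∑ v, biSum w y v ^ 2 := fun y => by
    rw [biSum_swap]
    exact Equiv.sum_comp (Equiv.sumComm B A) fun v => biSum w y v ^ 2
  rw [comp_swap_comp_perm, hsum, hsum]
  exact hx _

/-- Complete bipartite graphs with both parts of size at least three are weighted universal
antimagic. -/
theorem exists_injective_biSum (hA : 3 ≤ Fintype.card A) (hB : 3 ≤ Fintype.card B)
    (w : A ⊕ B → ℝ) {x : A × B → ℝ} (hinj : Function.Injective x) :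
    ∃ σ : Equiv.Perm (A × B), Function.Injective (biSum w (x ∘ σ)) := by
  suffices h : ∀ x : A × B → ℝ, Function.Injective x → IsMaxLabeling w x →
      ∃ σ : Equiv.Perm (A × B), Function.Injective (biSum w (x ∘ σ)) by
    obtain ⟨σ, hσ⟩ := exists_isMaxLabeling w x
    obtain ⟨τ, hτ⟩ := h _ (hinj.comp σ.injective) hσ
    exact ⟨σ * τ, hτ⟩
  clear hinj x
  intro x hinj hx
  have hends := hx.sum_ends_injective hinj
  have : Nonempty A := Fintype.card_pos_iff.1 (by omega)
  have : Nonempty B := Fintype.card_pos_iff.1 (by omega)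
  have hl : ∀ a a', biSum w x (.inl a) = biSum w x (.inl a') → a = a' := fun a a' h =>
    congrArg Prod.fst (@hends (a, Classical.arbitrary B) (a', Classical.arbitrary B)
      (by simp [-biSum_inl, h]))
  have hr : ∀ b b', biSum w x (.inr b) = biSum w x (.inr b') → b = b' := fun b b' h =>
    congrArg Prod.snd (@hends (Classical.arbitrary A, b) (Classical.arbitrary A, b')
      (by simp [-biSum_inr, h]))
  by_cases hcol : ∃ i j, biSum w x (.inl i) = biSum w x (.inr j)
  swap
  · push Not at hcol
    refine ⟨1, ?_⟩
    rintro (a | b) (a' | b') h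
    · rw [hl a a' h]
    · exact absurd h (hcol a b')
    · exact absurd h.symm (hcol a' b)
    · rw [hr b b' h]
  obtain ⟨i, j, hij⟩ := hcol
  have huniq : ∀ k l, biSum w x (.inl k) = biSum w x (.inr l) → k = i ∧ l = j := by
    intro k l hkl
    have := @hends (i, l) (k, j) (by simp only; linarith)
    simp only [Prod.mk.injEq] at this
    exact ⟨this.1.symm, this.2⟩
  have honr : Set.InjOn (biSum w x) {v | v ≠ .inr j} := by
    rintro (a | b) hu (a' | b') hv h
    · rw [hl a a' h]
    · exact absurd (congrArg Sum.inr (huniq a b' h).2) hv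
    · exact absurd (congrArg Sum.inr (huniq a' b h.symm).2) hu
    · rw [hr b b' h]
  have honl : Set.InjOn (biSum w x) {v | v ≠ .inl i} := by
    rintro (a | b) hu (a' | b') hv h
    · rw [hl a a' h]
    · exact absurd (congrArg Sum.inl (huniq a b' h).1) hu
    · exact absurd (congrArg Sum.inl (huniq a' b h.symm).1) hv
    · rw [hr b b' h]
  have : Nontrivial B := Fintype.one_lt_card_iff_nontrivial.1 (by omega)
  obtain ⟨j', hj'⟩ := exists_ne j
  obtain ⟨v, hv, hmin⟩ := exists_min_image
    (univ.filter fun v : A ⊕ B => v ≠ .inl i ∧ v ≠ .inr j)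
    (fun v => |biSum w x v - biSum w x (.inr j)|) ⟨.inr j', by simpa using hj'⟩
  simp only [mem_filter, mem_univ, true_and, and_imp] at hv hmin
  obtain k | l := v
  · obtain ⟨σ, hσ⟩ := hx.swap.exists_injective_of_nearest (i := j) (j := i) (l := k)
      (hinj.comp Prod.swap_injective) hB
      (by simpa only [biSum_swap, Function.comp, Sum.swap_inl, Sum.swap_inr] using hij.symm)
      (by rintro rfl; exact hv.1 rfl)
      (by
        rw [biSum_swap]
        intro u hu v hv h
        refine Sum.swap_leftInverse.injective (honl ?_ ?_ h)
        · exact fun h => hu (by simpa using congrArg Sum.swap h)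
        · exact fun h => hv (by simpa using congrArg Sum.swap h))
      (by
        intro v h1 h2
        simp only [biSum_swap, Function.comp_apply, Sum.swap_inr, hij]
        refine hmin _ ?_ ?_
        · exact fun h => h2 (by simpa using congrArg Sum.swap h)
        · exact fun h => h1 (by simpa using congrArg Sum.swap h))
    rw [comp_swap_comp_perm, biSum_swap] at hσ
    exact ⟨_, (Function.Injective.of_comp_iff' _ (Equiv.sumComm B A).bijective).1 hσ⟩
  · exact hx.exists_injective_of_nearest hinj hA hij (by rintro rfl; exact hv.2 rfl) honr hmin

end WeightedCompleteBipartite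

/-- There is a bijection onto `L` giving the smallest labels to a prescribed subset. -/
lemma exists_bijOn_lt {α : Type*} [DecidableEq α] (E₁ E₂ : Finset α) (hdisj : Disjoint E₁ E₂)
    (L : Finset ℝ) (hL : L.card = (E₁ ∪ E₂).card) :
    ∃ φ : α → ℝ, Set.BijOn φ ↑(E₁ ∪ E₂) ↑L ∧ ∀ a ∈ E₁, ∀ b ∈ E₂, φ a < φ b := by
  induction E₁ using Finset.induction_on generalizing L with
  | empty =>
    rw [empty_union] at hL ⊢
    obtain ⟨f, hf⟩ := (E₂.finite_toSet).exists_bijOn_of_encard_eq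
      (t := (L : Set ℝ)) (by simp [Set.encard_coe_eq_coe_finsetCard, hL])
    exact ⟨f, hf, by simp⟩
  | insert a s has ih =>
    rw [disjoint_insert_left] at hdisj
    have ha : a ∉ s ∪ E₂ := by simp [has, hdisj.1]
    rw [insert_union, card_insert_of_notMem ha] at hL
    have hne : L.Nonempty := card_pos.1 (by omega)
    have hmem := L.min'_mem hne
    obtain ⟨φ, hφ, hlt⟩ := ih hdisj.2 (L.erase (L.min' hne))
      (by rw [card_erase_of_mem hmem]; omega)
    have heq : ∀ e ∈ s ∪ E₂, Function.update φ a (L.min' hne) e = φ e := fun e he =>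
      Function.update_of_ne (by rintro rfl; exact ha he) _ _
    refine ⟨Function.update φ a (L.min' hne), ?_, ?_⟩
    · have h1 := (hφ.congr (f₂ := Function.update φ a (L.min' hne))
        fun e he => (heq e (by exact_mod_cast he)).symm).insert
        (a := a) (by simp)
      rw [insert_union, coe_insert]
      convert h1 using 1
      rw [Function.update_self, ← coe_insert, insert_erase hmem]
    · intro e he b hb
      have hbu : b ∈ s ∪ E₂ := mem_union_right _ hb
      rw [heq b hbu]
      rcases mem_insert.1 he with rfl | he
      · rw [Function.update_self]
        have hb' := mem_erase.1 (mem_coe.1 (hφ.mapsTo (mem_coe.2 hbu)))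
        exact lt_of_le_of_ne (L.min'_le _ hb'.2) hb'.1.symm
      · rw [heq e (mem_union_left _ he)]
        exact hlt e he b hb

/-- Let `m, n ≥ 3`. If `K_{m,n}` is a spanning subgraph of `G`, then
every leafy graph of `G` is universal antimagic. -/
theorem stmt_10 {V V' : Type*} [Fintype V] [Fintype V'] (m n : ℕ) (hm : 3 ≤ m) (hn : 3 ≤ n)
    (G : SimpleGraph V) (e : V ≃ (Fin m ⊕ Fin n))
    (hsub : ∀ a b : V, (completeBipartiteGraph (Fin m) (Fin n)).Adj (e a) (e b) → G.Adj a b)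
    (G' : SimpleGraph V') (hleafy : IsLeafyGraphOf G' G) :
    UnivAntimagic G' := by
  obtain ⟨f, hfadj, hleaf⟩ := hleafy
  intro L hLpos hLcard
  set E := edgeFS G' with hE
  have hmemE : ∀ x y, s(x, y) ∈ E ↔ G'.Adj x y := by simp [hE, edgeFS]
  let g : Fin m ⊕ Fin n ↪ V' := e.symm.toEmbedding.trans f
  have hgne : ∀ a b, g (.inl a) ≠ g (.inr b) := fun a b h => by simpa using g.injective h
  let κ : Fin m × Fin n ↪ Sym2 V' :=
    ⟨fun p => s(g (.inl p.1), g (.inr p.2)), by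
      rintro ⟨a, b⟩ ⟨a', b'⟩ h
      rcases Sym2.eq_iff.1 h with h | h
      · simpa using h
      · exact absurd h.1 (hgne _ _)⟩
  have hκ : ∀ a b, κ (a, b) = s(g (.inl a), g (.inr b)) := fun _ _ => rfl
  set K : Finset (Sym2 V') := univ.map κ with hK
  have hKE : K ⊆ E := by
    intro k hk
    obtain ⟨⟨a, b⟩, -, rfl⟩ := mem_map.1 hk
    rw [hκ, hmemE]
    exact (hfadj _ _).2 (hsub _ _ (by simp))
  obtain ⟨φ, hφ, hlt⟩ := exists_bijOn_lt (E \ K) K sdiff_disjoint L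
    (by rw [sdiff_union_of_subset hKE, hLcard])
  rw [sdiff_union_of_subset hKE] at hφ
  have hκE : ∀ p, κ p ∈ E := fun p => hKE (mem_map_of_mem κ (mem_univ p))
  let w : Fin m ⊕ Fin n → ℝ := fun v => ∑ k ∈ (E \ K).filter (fun k => g v ∈ k), φ k
  obtain ⟨σ, hσ⟩ := exists_injective_biSum (by simpa using hm) (by simpa using hn) w
    (x := φ ∘ κ) fun p q h => κ.injective (hφ.injOn (hκE p) (hκE q) h)
  let π : Equiv.Perm (Sym2 V') := σ.viaEmbedding κ
  have hπκ : ∀ p, π (κ p) = κ (σ p) := fun p => σ.viaEmbedding_apply κ p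
  have hπK : ∀ k, k ∉ K → π k = k := fun k hk =>
    σ.viaEmbedding_apply_of_notMem κ k (by simpa [hK] using hk)
  have hπmem : ∀ k ∈ E, π k ∈ E := by
    intro k hk
    by_cases hkK : k ∈ K
    · obtain ⟨p, -, rfl⟩ := mem_map.1 hkK
      rw [hπκ]
      exact hκE _
    · rwa [hπK k hkK]
  have hπbij : Set.BijOn π (E : Set (Sym2 V')) E := by
    refine ⟨hπmem, π.injective.injOn, ?_⟩
    exact surjOn_of_injOn_of_card_le π hπmem π.injective.injOn le_rfl
  have hψ : Set.BijOn (φ ∘ π) (E : Set (Sym2 V')) L := hφ.comp hπbij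
  have hψpos : ∀ k ∈ E, 0 < (φ ∘ π) k := fun k hk => hLpos _ (hψ.mapsTo hk)
  have hcore : ∀ v, vSum G' (φ ∘ π) (g v) = biSum w ((φ ∘ κ) ∘ σ) v := by
    intro v
    have hsplit : vSum G' (φ ∘ π) (g v) =
        w v + ∑ p ∈ univ.filter (fun p => g v ∈ κ p), φ (κ (σ p)) := by
      have h1 : ∑ k ∈ (E \ K).filter (fun k => g v ∈ k), (φ ∘ π) k = w v :=
        sum_congr rfl fun k hk => by
          simp [hπK k (mem_sdiff.1 (mem_filter.1 hk).1).2]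
      have h2 : ∑ k ∈ K.filter (fun k => g v ∈ k), (φ ∘ π) k =
          ∑ p ∈ univ.filter (fun p => g v ∈ κ p), φ (κ (σ p)) := by
        rw [hK, filter_map, sum_map]
        exact sum_congr rfl fun p _ => by simp [hπκ]
      rw [← h1, ← h2, vSum, ← hE, sum_filter, sum_filter, sum_filter, sum_sdiff hKE]
    rw [hsplit]
    obtain a | b := v
    · rw [biSum_inl]
      congr 1
      simp only [hκ, Sym2.mem_iff, sum_filter, Fintype.sum_prod_type]
      rw [sum_eq_single a] <;> simp [hgne, eq_comm] <;> grind
    · rw [biSum_inr]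
      congr 1
      simp only [hκ, Sym2.mem_iff, sum_filter, Fintype.sum_prod_type_right]
      rw [sum_eq_single b] <;> simp [(hgne _ _).symm, eq_comm] <;> grind
  have hrange : ∀ y, (∃ v, g v = y) ∨ y ∉ Set.range f := by
    intro y
    by_cases hy : y ∈ Set.range f
    · obtain ⟨v, rfl⟩ := hy
      exact .inl ⟨e v, by simp [g]⟩
    · exact .inr hy
  have hpend : ∀ y, y ∉ Set.range f → ∃ k ∈ E \ K, vSum G' (φ ∘ π) y = (φ ∘ π) k ∧
      y ∈ k ∧ ∀ z ∈ k, z = y ∨ z ∈ Set.range f := by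
    intro y hy
    obtain ⟨hdeg, v, hv, -⟩ := hleaf y hy
    have hmem : s(y, f v) ∈ E := (hmemE _ _).2 hv
    obtain ⟨z, -, hz⟩ := SimpleGraph.degree_eq_one_iff_existsUnique_adj.1 hdeg
    have hfil : E.filter (fun k => y ∈ k) = {s(y, f v)} := by
      ext k
      simp only [mem_filter, mem_singleton]
      constructor
      · rintro ⟨hk, hyk⟩
        obtain ⟨u, rfl⟩ := Sym2.mem_iff_exists.1 hyk
        rw [hz _ ((hmemE _ _).1 hk), hz _ hv]
      · rintro rfl
        exact ⟨hmem, Sym2.mem_mk_left _ _⟩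
    refine ⟨s(y, f v), mem_sdiff.2 ⟨hmem, ?_⟩, by rw [vSum, ← hE, hfil, sum_singleton],
      Sym2.mem_mk_left _ _, ?_⟩
    · intro hk
      obtain ⟨⟨a, b⟩, -, h⟩ := mem_map.1 hk
      have : y ∈ κ (a, b) := h ▸ Sym2.mem_mk_left _ _
      rw [hκ, Sym2.mem_iff] at this
      rcases this with rfl | rfl <;> exact hy ⟨_, rfl⟩
    · intro z hz
      rcases Sym2.mem_iff.1 hz with rfl | rfl
      · exact .inl rfl
      · exact .inr ⟨v, rfl⟩
  have hψlt : ∀ k ∈ E \ K, ∀ p, (φ ∘ π) k < (φ ∘ π) (κ p) := fun k hk p => by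
    simp only [Function.comp, hπK k (mem_sdiff.1 hk).2, hπκ]
    exact hlt k hk _ (mem_map_of_mem κ (mem_univ _))
  have hbig : ∀ v, ∀ k ∈ E \ K, (φ ∘ π) k < vSum G' (φ ∘ π) (g v) := by
    intro v k hk
    obtain ⟨p, hp⟩ : ∃ p, g v ∈ κ p := by
      obtain a | b := v
      · exact ⟨(a, ⟨0, by omega⟩), Sym2.mem_mk_left _ _⟩
      · exact ⟨(⟨0, by omega⟩, b), Sym2.mem_mk_right _ _⟩
    refine (hψlt k hk p).trans_le ?_
    exact single_le_sum (f := φ ∘ π) (fun k hk => (hψpos k (mem_filter.1 hk).1).le)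
      (mem_filter.2 ⟨hκE p, hp⟩)
  refine ⟨φ ∘ π, hψ, fun y z hyz => ?_⟩
  rcases hrange y with ⟨u, rfl⟩ | hy <;> rcases hrange z with ⟨v, rfl⟩ | hz
  · rw [hcore, hcore] at hyz
    rw [hσ hyz]
  · obtain ⟨k, hk, hs, -⟩ := hpend z hz
    exact absurd (hyz.trans hs) (hbig u k hk).ne'
  · obtain ⟨k, hk, hs, -⟩ := hpend y hy
    exact absurd (hyz.symm.trans hs) (hbig v k hk).ne'
  · obtain ⟨k, hk, hs, hky, hkr⟩ := hpend y hy
    obtain ⟨l, hl, ht, hlz, hlr⟩ := hpend z hz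
    have hkl : k = l := hψ.injOn (mem_sdiff.1 hk).1 (mem_sdiff.1 hl).1
      (hs.symm.trans (hyz.trans ht))
    subst hkl
    exact (hlr y hky).resolve_right hy
end
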